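/- arXiv:0710.5338 — 4 statements merged into one kernel-verified Lean document; each statement's English description precedes it below -/
import Mathlib

section
/- Fix constants δ ∈ (0,1) and c > 1. There exists a constant d > 0, depending only on δ and c, such that in the random fs-relation graph model with n1 = δn and n2 = (1-δ)n (δn an integer) and with m - n ≥ m/c, the random variable Z = Σ_{v ∈ T} Z_v satisfies Var[Z] ≤ d·|T|/m³. -/
open scoped Classical
open Finset

noncomputable section

/-- The sample space of the random fs-relation graph model with `n1` applicants of the
first category, `n2` applicants of the second category, and `m` items: an outcome
records the `f1`-, `s1`-, `f2`- and `s2`-items assigned to the applicants. -/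
abbrev FSSpace (n1 n2 m : ℕ) : Type :=
  (Fin n1 → Fin m) × (Fin n1 → Fin m) × (Fin n2 → Fin m) × (Fin n2 → Fin m)

/-- the `f1`-items of an outcome. -/
def fOne {n1 n2 m : ℕ} (ω : FSSpace n1 n2 m) : Fin n1 → Fin m := ω.1
/-- the `s1`-items of an outcome. -/
def sOne {n1 n2 m : ℕ} (ω : FSSpace n1 n2 m) : Fin n1 → Fin m := ω.2.1
/-- the `f2`-items of an outcome. -/
def fTwo {n1 n2 m : ℕ} (ω : FSSpace n1 n2 m) : Fin n2 → Fin m := ω.2.2.1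
/-- the `s2`-items of an outcome. -/
def sTwo {n1 n2 m : ℕ} (ω : FSSpace n1 n2 m) : Fin n2 → Fin m := ω.2.2.2

/-- the set `F1` of an outcome. -/
def FOne {n1 n2 m : ℕ} (ω : FSSpace n1 n2 m) : Finset (Fin m) := Finset.univ.image (fOne ω)
/-- the set `F2` of an outcome. -/
def FTwo {n1 n2 m : ℕ} (ω : FSSpace n1 n2 m) : Finset (Fin m) := Finset.univ.image (fTwo ω)

/-- an outcome is valid if each `s1`- and `f2`-item avoids `F1` and each `s2`-item
avoids `F1 ∪ F2`, as in the sequential random process. -/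
def FSValid {n1 n2 m : ℕ} (ω : FSSpace n1 n2 m) : Prop :=
  (∀ x, sOne ω x ∉ FOne ω) ∧ (∀ y, fTwo ω y ∉ FOne ω) ∧
    (∀ y, sTwo ω y ∉ FOne ω ∪ FTwo ω)

/-- the probability of a single outcome under the sequential random process:
the `f1`-items are independent and uniform on the `m` items, then the `s1`- and
`f2`-items are independent and uniform on the items outside `F1`, then the
`s2`-items are independent and uniform on the items outside `F1 ∪ F2`. -/
def fsWeight (n1 n2 m : ℕ) (ω : FSSpace n1 n2 m) : ℝ :=
  if FSValid ω then
    (1 / (m : ℝ)) ^ n1 * (1 / ((m : ℝ) - (FOne ω).card)) ^ (n1 + n2) *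
      (1 / ((m : ℝ) - ((FOne ω) ∪ (FTwo ω)).card)) ^ n2
  else 0

/-- the probability of an event in the random fs-relation graph model. -/
def fsProb (n1 n2 m : ℕ) (S : FSSpace n1 n2 m → Prop) : ℝ :=
  ∑ ω : FSSpace n1 n2 m, if S ω then fsWeight n1 n2 m ω else 0

/-- the expectation of a random variable in the random fs-relation graph model. -/
def fsExp (n1 n2 m : ℕ) (f : FSSpace n1 n2 m → ℝ) : ℝ :=
  ∑ ω : FSSpace n1 n2 m, fsWeight n1 n2 m ω * f ω

/-- the index set `T` of tuples `(x1, x2, y1, y2)` with `x1 < x2` and `y1 ≠ y2`. -/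
def Ttup (n1 n2 : ℕ) : Finset (Fin n1 × Fin n1 × Fin n2 × Fin n2) :=
  Finset.univ.filter fun v => v.1 < v.2.1 ∧ v.2.2.1 ≠ v.2.2.2

/-- the event `{Z_v = 1}`, i.e. `f1(x1) = f1(x2)`, `f2(y1) = s1(x1)`, `f2(y2) = s1(x2)`. -/
def ZEvent {n1 n2 m : ℕ} (v : Fin n1 × Fin n1 × Fin n2 × Fin n2)
    (ω : FSSpace n1 n2 m) : Prop :=
  fOne ω v.1 = fOne ω v.2.1 ∧ fTwo ω v.2.2.1 = sOne ω v.1 ∧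
    fTwo ω v.2.2.2 = sOne ω v.2.1

/-- the indicator random variable `Z_v`. -/
def Zind {n1 n2 m : ℕ} (v : Fin n1 × Fin n1 × Fin n2 × Fin n2)
    (ω : FSSpace n1 n2 m) : ℝ :=
  if ZEvent v ω then 1 else 0

/-- the random variable `Z = ∑_{v ∈ T} Z_v`. -/
def Ztotal (n1 n2 m : ℕ) (ω : FSSpace n1 n2 m) : ℝ :=
  ∑ v ∈ Ttup n1 n2, Zind v ω

/-- `T_h(v)`: the tuples `w ∈ T \ {v}` that are `h`-common to `v`,
i.e. `|{x1, x2} ∩ {x1', x2'}| = h`. -/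
def Tcommon (n1 n2 : ℕ) (h : ℕ) (v : Fin n1 × Fin n1 × Fin n2 × Fin n2) :
    Finset (Fin n1 × Fin n1 × Fin n2 × Fin n2) :=
  (Ttup n1 n2).filter fun w =>
    w ≠ v ∧ (({v.1, v.2.1} : Finset (Fin n1)) ∩ ({w.1, w.2.1} : Finset (Fin n1))).card = h

/-- the edge of applicant `a` (first or second category) joins items `p` and `q`
in the fs-relation graph of the outcome `ω`. -/
def fsJoins {n1 n2 m : ℕ} (ω : FSSpace n1 n2 m) (a : Fin n1 ⊕ Fin n2)
    (p q : Fin m) : Prop :=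
  Sum.elim (fun x => (fOne ω x = p ∧ sOne ω x = q) ∨ (fOne ω x = q ∧ sOne ω x = p))
    (fun y => (fTwo ω y = p ∧ sTwo ω y = q) ∨ (fTwo ω y = q ∧ sTwo ω y = p)) a

/-- the fs-relation graph of the outcome contains a cycle: a closed walk on `ℓ ≥ 2`
distinct vertices using `ℓ` distinct edges. -/
def fsHasCycle {n1 n2 m : ℕ} (ω : FSSpace n1 n2 m) : Prop :=
  ∃ (ℓ : ℕ) (u : ℕ → Fin m) (c : ℕ → Fin n1 ⊕ Fin n2),
    2 ≤ ℓ ∧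
    (∀ i j, i < ℓ → j < ℓ → u i = u j → i = j) ∧
    (∀ i j, i < ℓ → j < ℓ → c i = c j → i = j) ∧
    (∀ i, i < ℓ → fsJoins ω (c i) (u i) (u ((i + 1) % ℓ)))

/-- the fs-relation graph of the outcome contains a simple path with `ℓ ≥ 4`
distinct edges and `ℓ + 1` distinct vertices. -/
def fsHasLongPath {n1 n2 m : ℕ} (ω : FSSpace n1 n2 m) : Prop :=
  ∃ (ℓ : ℕ) (v : ℕ → Fin m) (e : ℕ → Fin n1 ⊕ Fin n2),
    4 ≤ ℓ ∧
    (∀ i j, i ≤ ℓ → j ≤ ℓ → v i = v j → i = j) ∧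
    (∀ i j, i < ℓ → j < ℓ → e i = e j → i = j) ∧
    (∀ i, i < ℓ → fsJoins ω (e i) (v i) (v (i + 1)))

open scoped BigOperators

/-- The real-valued indicator of `i = j`. -/
def eqInd {α : Type*} (i j : α) : ℝ := if i = j then 1 else 0

theorem eqInd_nonneg {α : Type*} (i j : α) : 0 ≤ eqInd i j := by
  unfold eqInd; split_ifs <;> norm_num

theorem eqInd_le_one {α : Type*} (i j : α) : eqInd i j ≤ 1 := by
  unfold eqInd; split_ifs <;> norm_num

@[simp] theorem eqInd_self {α : Type*} (i : α) : eqInd i i = 1 := by simp [eqInd]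

theorem eqInd_of_ne {α : Type*} {i j : α} (h : i ≠ j) : eqInd i j = 0 := by simp [eqInd, h]

theorem eqInd_comm {α : Type*} (i j : α) : eqInd i j = eqInd j i := by
  simp [eqInd, eq_comm]

theorem eqInd_mul_self {α : Type*} (i j : α) : eqInd i j * eqInd i j = eqInd i j := by
  unfold eqInd; split_ifs <;> norm_num

section Uniform

variable {ι β : Type*} [Fintype ι] [DecidableEq ι] [Fintype β]

theorem sum_sum_update (i : ι) (H : (ι → β) → ℝ) :
    ∑ g : ι → β, ∑ b : β, H (Function.update g i b) = Fintype.card β * ∑ g, H g := by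
  have hinv : Function.Involutive
      (fun p : (ι → β) × β => (Function.update p.1 i p.2, p.1 i)) := by
    rintro ⟨g, b⟩
    simp
  have h := Equiv.sum_comp hinv.toPerm (fun p : (ι → β) × β => H p.1)
  rw [Fintype.sum_prod_type, Fintype.sum_prod_type] at h
  simpa [Finset.mul_sum] using h

/-- `G` does not depend on the coordinate `i`. -/
def Indep (i : ι) (G : (ι → β) → ℝ) : Prop := ∀ g b, G (Function.update g i b) = G g

omit [Fintype ι] [Fintype β] in
theorem Indep.mul {i : ι} {G H : (ι → β) → ℝ} (hG : Indep i G) (hH : Indep i H) :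
    Indep i (fun g => G g * H g) := fun g b => by simp only [hG g b, hH g b]

omit [Fintype ι] [Fintype β] in
theorem indep_one {i : ι} : Indep i (fun _ : ι → β => (1 : ℝ)) := fun _ _ => rfl

omit [Fintype ι] [Fintype β] in
theorem indep_eqInd {i j k : ι} (hj : j ≠ i) (hk : k ≠ i) :
    Indep i (fun g : ι → β => eqInd (g j) (g k)) := fun g b => by simp [hj, hk]

theorem expect_mul_eqInd [Nonempty β] {i j : ι} (hij : j ≠ i) {G : (ι → β) → ℝ}
    (hG : Indep i G) :
    𝔼 g, G g * eqInd (g i) (g j) = (Fintype.card β : ℝ)⁻¹ * 𝔼 g, G g := by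
  have hβ : (Fintype.card β : ℝ) ≠ 0 := by simp
  have h := sum_sum_update i (fun g => G g * eqInd (g i) (g j))
  have h2 : ∀ g : ι → β, ∑ b : β, G (Function.update g i b) *
      eqInd (Function.update g i b i) (Function.update g i b j) = G g := by
    intro g
    simp [hG g, hij, eqInd]
  simp only [h2] at h
  rw [Finset.expect_eq_sum_div_card, Finset.expect_eq_sum_div_card, h]
  field_simp

theorem expect_mul_eqInd_symm [Nonempty β] {i j : ι} (hij : j ≠ i) {G : (ι → β) → ℝ}
    (hG : Indep i G) :
    𝔼 g, G g * eqInd (g j) (g i) = (Fintype.card β : ℝ)⁻¹ * 𝔼 g, G g := by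
  simp only [eqInd_comm (_ : β) _]
  exact expect_mul_eqInd hij hG

end Uniform

/-- The items missed by `f`. -/
abbrev Missed {ι β : Type*} (f : ι → β) : Type _ := {b : β // ∀ i, f i ≠ b}

theorem card_missed {n m : ℕ} (f : Fin n → Fin m) :
    (Fintype.card (Missed f) : ℝ) = m - ((univ.image f).card : ℝ) := by
  have h1 : Fintype.card (Missed f) = ((univ.image f)ᶜ).card := by
    rw [Fintype.card_subtype]
    congr 1
    ext b
    simp
  have h2 := card_add_card_compl (univ.image f)
  rw [h1]
  rw [Fintype.card_fin] at h2
  have : ((univ.image f).card : ℝ) + ((univ.image f)ᶜ).card = m := by exact_mod_cast h2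
  linarith

theorem sum_avoiding {n m : ℕ} (A : Finset (Fin m)) (hA : A.card < m) :
    ∑ t : Fin n → Fin m, (if ∀ y, t y ∉ A then (1 / ((m : ℝ) - A.card)) ^ n else 0) = 1 := by
  have h2 := card_add_card_compl A
  rw [Fintype.card_fin] at h2
  have h3 : (m : ℝ) - A.card = (Aᶜ.card : ℝ) := by
    have : (A.card : ℝ) + Aᶜ.card = m := by exact_mod_cast h2
    linarith
  have h4 : (Aᶜ.card : ℝ) ≠ 0 := by
    have : Aᶜ.card ≠ 0 := by omega
    exact_mod_cast this
  rw [← Finset.sum_filter, Finset.sum_const, h3]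
  have h5 : (univ.filter fun t : Fin n → Fin m => ∀ y, t y ∉ A)
      = Fintype.piFinset fun _ => Aᶜ := by
    ext t; simp [Fintype.mem_piFinset]
  rw [h5, Fintype.card_piFinset]
  simp [h4]

theorem fsExp_eq_expect {n1 n2 m : ℕ} (h : n1 + n2 < m)
    (φ : (Fin n1 → Fin m) → (Fin n1 → Fin m) → (Fin n2 → Fin m) → ℝ) :
    fsExp n1 n2 m (fun ω => φ (fOne ω) (sOne ω) (fTwo ω)) =
      𝔼 f : Fin n1 → Fin m, 𝔼 g : Fin n1 ⊕ Fin n2 → Missed f,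
        φ f (fun x => g (Sum.inl x)) (fun y => g (Sum.inr y)) := by
  rw [Finset.expect_eq_sum_div_card, Finset.sum_div]
  unfold fsExp
  rw [Fintype.sum_prod_type]
  refine Finset.sum_congr rfl fun f _ => ?_
  rw [Finset.expect_eq_sum_div_card]
  simp only [card_univ, Fintype.card_fun, Fintype.card_sum, Fintype.card_fin, Nat.cast_pow,
    card_missed]
  rw [Fintype.sum_prod_type]
  simp_rw [Fintype.sum_prod_type]
  have inner : ∀ (s : Fin n1 → Fin m) (k : Fin n2 → Fin m),
      ∑ t : Fin n2 → Fin m, fsWeight n1 n2 m (f, s, k, t) *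
        φ (fOne (f, s, k, t)) (sOne (f, s, k, t)) (fTwo (f, s, k, t)) =
      if (∀ x, s x ∉ univ.image f) ∧ (∀ y, k y ∉ univ.image f) then
        (1 / (m : ℝ)) ^ n1 * (1 / ((m : ℝ) - (univ.image f).card)) ^ (n1 + n2) * φ f s k
      else 0 := by
    intro s k
    split_ifs with hv
    · have hc : (univ.image f ∪ univ.image k).card < m := by
        have h1 := card_union_le (univ.image f) (univ.image k)
        have h2 := card_image_le (s := univ) (f := f)
        have h3 := card_image_le (s := univ) (f := k)
        simp only [card_univ, Fintype.card_fin] at h2 h3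
        omega
      rw [← mul_one ((1 / (m : ℝ)) ^ n1 * _ * φ f s k)]
      refine Eq.trans ?_ (congrArg (_ * ·) (sum_avoiding (n := n2) _ hc))
      simp only [Finset.mul_sum]
      refine Finset.sum_congr rfl fun t _ => ?_
      by_cases ht : ∀ y, t y ∉ univ.image f ∪ univ.image k
      · have hval : FSValid (f, s, k, t) := ⟨hv.1, hv.2, ht⟩
        rw [fsWeight, if_pos hval, if_pos ht]
        simp only [fOne, sOne, fTwo, FOne, FTwo]
        ring
      · have hval : ¬FSValid (f, s, k, t) := fun h => ht h.2.2
        rw [fsWeight, if_neg hval, if_neg ht]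
        ring
    · refine Finset.sum_eq_zero fun t _ => ?_
      have hval : ¬FSValid (f, s, k, t) := fun h => hv ⟨h.1, h.2.1⟩
      rw [fsWeight, if_neg hval, zero_mul]
  simp_rw [inner]
  rw [← Fintype.sum_prod_type'
    (f := fun (s : Fin n1 → Fin m) (k : Fin n2 → Fin m) =>
      if (∀ x, s x ∉ univ.image f) ∧ (∀ y, k y ∉ univ.image f) then
        (1 / (m : ℝ)) ^ n1 * (1 / ((m : ℝ) - (univ.image f).card)) ^ (n1 + n2) * φ f s k
      else 0)]
  rw [Finset.sum_div, Finset.sum_div]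
  symm
  refine Finset.sum_of_injOn (fun g => (fun x => (g (Sum.inl x)).1, fun y => (g (Sum.inr y)).1))
    ?_ ?_ ?_ ?_
  · intro g _ g' _ hg
    simp only [Prod.mk.injEq, funext_iff] at hg
    ext i
    rcases i with x | y
    · exact congrArg _ (hg.1 x)
    · exact congrArg _ (hg.2 y)
  · intro g _; simp
  · rintro ⟨s, k⟩ _ hn
    refine if_neg fun hv => hn ?_
    simp only [mem_image, mem_univ, true_and, not_exists] at hv
    exact ⟨Sum.elim (fun x => ⟨s x, hv.1 x⟩) (fun y => ⟨k y, hv.2 y⟩), by simp, rfl⟩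
  · intro g _
    rw [if_pos]
    · simp only [one_div, inv_pow]
      ring
    · simp only [mem_image, mem_univ, true_and, not_exists]
      exact ⟨fun x => (g _).2, fun y => (g _).2⟩

section Missed

variable {ι β : Type*} [Fintype ι] [DecidableEq ι] [Fintype β]

/-- The items missed by the restriction of `f` to the complement of `S`. -/
def missedOff (S : Finset ι) (f : ι → β) : Finset β := univ.filter fun b => ∀ i ∉ S, f i ≠ b

theorem card_missedOff_empty (f : ι → β) [Fintype (Missed f)] :
    Fintype.card (Missed f) = (missedOff ∅ f).card :=
  Fintype.card_of_subtype (missedOff ∅ f) fun b => by simp [missedOff]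

theorem missedOff_mono {S S' : Finset ι} (h : S ⊆ S') (f : ι → β) :
    missedOff S f ⊆ missedOff S' f := by
  intro b hb
  simp only [missedOff, mem_filter, mem_univ, true_and] at hb ⊢
  exact fun i hi => hb i fun hi' => hi (h hi')

theorem missedOff_insert {S : Finset ι} {i j : ι} {f : ι → β} (hij : j ≠ i) (hj : j ∉ S)
    (h : f i = f j) : missedOff (insert i S) f = missedOff S f := by
  refine Subset.antisymm ?_ (missedOff_mono (subset_insert i S) f)
  intro b hb
  simp only [missedOff, mem_filter, mem_univ, true_and] at hb ⊢
  intro k hk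
  by_cases hki : k = i
  · rw [hki, h]
    exact hb j (by simp [hij, hj])
  · exact hb k (by simp [hki, hk])

theorem missedOff_update {S : Finset ι} {i : ι} (hi : i ∈ S) (f : ι → β) (b : β) :
    missedOff S (Function.update f i b) = missedOff S f := by
  ext q
  simp only [missedOff, mem_filter, mem_univ, true_and]
  refine forall₂_congr fun k hk => ?_
  have hki : k ≠ i := by rintro rfl; exact hk hi
  rw [Function.update_of_ne hki]

theorem card_missedOff_singleton_le (i : ι) (f : ι → β) :
    (missedOff {i} f).card ≤ (missedOff ∅ f).card + 1 := by
  have : missedOff {i} f ⊆ insert (f i) (missedOff ∅ f) := by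
    intro b hb
    simp only [missedOff, mem_insert, mem_filter, mem_univ, true_and] at hb ⊢
    by_cases h : b = f i
    · exact Or.inl h
    · refine Or.inr fun k _ => ?_
      by_cases hk : k = i
      · rw [hk]; exact fun h' => h h'.symm
      · exact hb k (by simp [hk])
  exact (card_le_card this).trans (card_insert_le _ _)

theorem expect_prod_apply (h : β → ℝ) :
    𝔼 f : ι → β, ∏ i, h (f i) = (𝔼 b, h b) ^ Fintype.card ι := by
  rw [Finset.expect_eq_sum_div_card, Finset.expect_eq_sum_div_card, div_pow]
  have := Finset.prod_univ_sum (fun _ : ι => (univ : Finset β)) (fun _ b => h b)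
  simp only [Fintype.piFinset_univ, prod_const, card_univ] at this
  rw [this]
  simp

theorem expect_eqInd [Nonempty β] (b : β) : 𝔼 q, eqInd q b = (Fintype.card β : ℝ)⁻¹ := by
  simp [Finset.expect_eq_sum_div_card, eqInd]

theorem card_missedOff_eq_sum (f : ι → β) :
    ((missedOff ∅ f).card : ℝ) = ∑ b, ∏ i, (1 - eqInd (f i) b) := by
  rw [missedOff, card_filter]
  push_cast
  refine Finset.sum_congr rfl fun b _ => ?_
  split_ifs with h
  · exact (Finset.prod_eq_one fun i _ => by rw [eqInd_of_ne (h i (by simp)), sub_zero]).symm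
  · push Not at h
    obtain ⟨i, -, hi⟩ := h
    exact (Finset.prod_eq_zero (mem_univ i) (by simp [hi])).symm

theorem expect_card_missedOff [Nonempty β] :
    𝔼 f : ι → β, ((missedOff ∅ f).card : ℝ) =
      Fintype.card β * (1 - (Fintype.card β : ℝ)⁻¹) ^ Fintype.card ι := by
  simp_rw [card_missedOff_eq_sum]
  rw [Finset.expect_sum_comm]
  have : ∀ b : β, 𝔼 f : ι → β, ∏ i, (1 - eqInd (f i) b) =
      (1 - (Fintype.card β : ℝ)⁻¹) ^ Fintype.card ι := by
    intro b
    rw [expect_prod_apply (fun q => 1 - eqInd q b), Finset.expect_sub_distrib,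
      expect_eqInd, Finset.expect_const univ_nonempty]
  simp [this]

theorem expect_card_missedOff_sq_le [Nonempty β] :
    𝔼 f : ι → β, ((missedOff ∅ f).card : ℝ) ^ 2 ≤
      Fintype.card β + (𝔼 f : ι → β, ((missedOff ∅ f).card : ℝ)) ^ 2 := by
  rw [expect_card_missedOff]
  simp_rw [card_missedOff_eq_sum, sq, Finset.sum_mul_sum, ← Finset.prod_mul_distrib]
  rw [Finset.expect_sum_comm]
  simp_rw [Finset.expect_sum_comm (ι := ι → β)]
  have hβ : (1 : ℝ) ≤ Fintype.card β := by exact_mod_cast Fintype.card_pos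
  have hinv : (Fintype.card β : ℝ)⁻¹ ≤ 1 := inv_le_one_of_one_le₀ hβ
  have hinv0 : 0 ≤ (Fintype.card β : ℝ)⁻¹ := by positivity
  have key : ∀ b b' : β, 𝔼 f : ι → β, ∏ i, ((1 - eqInd (f i) b) * (1 - eqInd (f i) b')) ≤
      eqInd b b' + ((1 - (Fintype.card β : ℝ)⁻¹) ^ Fintype.card ι) ^ 2 := by
    intro b b'
    rw [expect_prod_apply (fun q => (1 - eqInd q b) * (1 - eqInd q b'))]
    have h0 : 0 ≤ 𝔼 q : β, (1 - eqInd q b) * (1 - eqInd q b') :=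
      Finset.expect_nonneg fun q _ => mul_nonneg (sub_nonneg.2 (eqInd_le_one _ _))
        (sub_nonneg.2 (eqInd_le_one _ _))
    by_cases hb : b = b'
    · rw [hb, eqInd_self]
      have h1 : 𝔼 q : β, (1 - eqInd q b) * (1 - eqInd q b') ≤ 1 :=
        Finset.expect_le univ_nonempty fun q _ => mul_le_one₀
          (by linarith [eqInd_nonneg q b]) (sub_nonneg.2 (eqInd_le_one _ _))
          (by linarith [eqInd_nonneg q b'])
      rw [hb] at h0 h1
      have := pow_le_one₀ (n := Fintype.card ι) h0 h1
      nlinarith [sq_nonneg ((1 - (Fintype.card β : ℝ)⁻¹) ^ Fintype.card ι)]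
    · rw [eqInd_of_ne hb, zero_add, ← pow_mul, mul_comm _ 2, pow_mul]
      refine pow_le_pow_left₀ h0 ?_ _
      have : ∀ q : β, (1 - eqInd q b) * (1 - eqInd q b') = 1 - eqInd q b - eqInd q b' := by
        intro q
        have : eqInd q b * eqInd q b' = 0 := by
          by_cases h : q = b
          · rw [h, eqInd_of_ne hb, mul_zero]
          · rw [eqInd_of_ne h, zero_mul]
        linear_combination this
      simp_rw [this]
      rw [Finset.expect_sub_distrib, Finset.expect_sub_distrib, expect_eqInd, expect_eqInd,
        Finset.expect_const univ_nonempty]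
      nlinarith [sq_nonneg (Fintype.card β : ℝ)⁻¹]
  refine (Finset.sum_le_sum fun b _ => Finset.sum_le_sum fun b' _ => key b b').trans_eq ?_
  simp only [Finset.sum_add_distrib, eqInd, Finset.sum_ite_eq, mem_univ, if_true, sum_const,
    card_univ, nsmul_eq_mul, mul_one]
  ring

omit [DecidableEq ι] in
theorem expect_sub_sq [Nonempty ι] (X : ι → ℝ) (t : ℝ) :
    𝔼 i, (X i - t) ^ 2 = 𝔼 i, X i ^ 2 - 2 * t * 𝔼 i, X i + t ^ 2 := by
  have : ∀ i, (X i - t) ^ 2 = X i ^ 2 - 2 * t * X i + t ^ 2 := fun i => by ring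
  simp_rw [this]
  rw [Finset.expect_add_distrib, Finset.expect_sub_distrib, ← Finset.mul_expect,
    Finset.expect_const univ_nonempty]

theorem inv_sq_sub_inv_sq_sq_le {a M x y : ℝ} (ha : 0 < a) (hx : a ≤ x) (hy : a ≤ y)
    (hxM : x ≤ M) (hyM : y ≤ M) :
    ((x ^ 2)⁻¹ - (y ^ 2)⁻¹) ^ 2 ≤ 4 * M ^ 2 / a ^ 8 * (x - y) ^ 2 := by
  have hx0 : 0 < x := ha.trans_le hx
  have hy0 : 0 < y := ha.trans_le hy
  have h : ((x ^ 2)⁻¹ - (y ^ 2)⁻¹) ^ 2 = (x + y) ^ 2 / (x ^ 4 * y ^ 4) * (x - y) ^ 2 := by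
    field_simp
    ring
  rw [h]
  refine mul_le_mul_of_nonneg_right ?_ (sq_nonneg _)
  refine div_le_div₀ (by positivity) ?_ (by positivity) ?_
  · nlinarith
  · calc a ^ 8 = a ^ 4 * a ^ 4 := by ring
      _ ≤ x ^ 4 * y ^ 4 := by gcongr

theorem variance_inv_missed_sq_le [Nonempty β] {a : ℝ} (ha : 0 < a)
    (h : ∀ f : ι → β, a ≤ (missedOff ∅ f).card) :
    𝔼 f : ι → β, (((missedOff ∅ f).card : ℝ) ^ 2)⁻¹ ^ 2 -
      (𝔼 f : ι → β, (((missedOff ∅ f).card : ℝ) ^ 2)⁻¹) ^ 2 ≤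
        4 * (Fintype.card β : ℝ) ^ 3 / a ^ 8 := by
  set μ := 𝔼 f : ι → β, ((missedOff ∅ f).card : ℝ) with hμ
  have hle : ∀ f : ι → β, ((missedOff ∅ f).card : ℝ) ≤ Fintype.card β := fun f => by
    exact_mod_cast card_le_univ _
  have h1 : a ≤ μ := Finset.le_expect univ_nonempty fun f _ => h f
  have h2 : μ ≤ Fintype.card β := Finset.expect_le univ_nonempty fun f _ => hle f
  have h3 := expect_sub_sq (fun f : ι → β => (((missedOff ∅ f).card : ℝ) ^ 2)⁻¹) (μ ^ 2)⁻¹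
  have h4 := expect_sub_sq (fun f : ι → β => ((missedOff ∅ f).card : ℝ)) μ
  have h5 := expect_card_missedOff_sq_le (ι := ι) (β := β)
  have h6 : 𝔼 f : ι → β, ((((missedOff ∅ f).card : ℝ) ^ 2)⁻¹ - (μ ^ 2)⁻¹) ^ 2 ≤
      𝔼 f : ι → β, 4 * (Fintype.card β : ℝ) ^ 2 / a ^ 8 * ((missedOff ∅ f).card - μ) ^ 2 :=
    Finset.expect_le_expect fun f _ => inv_sq_sub_inv_sq_sq_le ha (h f) h1 (hle f) h2
  rw [← Finset.mul_expect] at h6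
  have h7 : 𝔼 f : ι → β, ((missedOff ∅ f).card - μ) ^ 2 ≤ Fintype.card β := by
    rw [h4, ← hμ]
    rw [← hμ] at h5
    linarith
  have h8 : 4 * (Fintype.card β : ℝ) ^ 2 / a ^ 8 * 𝔼 f : ι → β, ((missedOff ∅ f).card - μ) ^ 2 ≤
      4 * (Fintype.card β : ℝ) ^ 2 / a ^ 8 * Fintype.card β :=
    mul_le_mul_of_nonneg_left h7 (by positivity)
  have h9 : 4 * (Fintype.card β : ℝ) ^ 2 / a ^ 8 * Fintype.card β =
    4 * (Fintype.card β : ℝ) ^ 3 / a ^ 8 := by ring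
  nlinarith [sq_nonneg (𝔼 f : ι → β, (((missedOff ∅ f).card : ℝ) ^ 2)⁻¹ - (μ ^ 2)⁻¹)]

end Missed

section Collisions

variable {ι β : Type*} [Fintype ι] [DecidableEq ι] [Fintype β] [Nonempty β]

theorem expect_eqInd_apply {i j : ι} (hij : i ≠ j) :
    𝔼 g : ι → β, eqInd (g i) (g j) = (Fintype.card β : ℝ)⁻¹ := by
  have := expect_mul_eqInd (β := β) hij.symm (indep_one (i := i))
  simpa using this

theorem expect_two_collisions {a b b' : ι} (hab : a ≠ b) (hab' : a ≠ b') (hbb' : b ≠ b') :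
    𝔼 g : ι → β, eqInd (g a) (g b) * eqInd (g a) (g b') = (Fintype.card β : ℝ)⁻¹ ^ 2 := by
  rw [expect_mul_eqInd_symm hab' (indep_eqInd hab' hbb'), expect_eqInd_apply hab, sq]

omit [Nonempty β] in
theorem eqInd_mul_inv_card_missed {x y : ι} (hxy : x ≠ y) (f : ι → β) :
    eqInd (f x) (f y) * (((missedOff ∅ f).card : ℝ) ^ 2)⁻¹ =
      (((missedOff {y} f).card : ℝ) ^ 2)⁻¹ * eqInd (f x) (f y) := by
  by_cases h : f x = f y
  · rw [← insert_empty_eq, missedOff_insert hxy (by simp) h.symm, mul_comm]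
  · rw [eqInd_of_ne h]; ring

theorem expect_collision_mul_inv {x y : ι} (hxy : x ≠ y) :
    𝔼 f : ι → β, eqInd (f x) (f y) * (((missedOff ∅ f).card : ℝ) ^ 2)⁻¹ =
      (Fintype.card β : ℝ)⁻¹ * 𝔼 f : ι → β, (((missedOff {y} f).card : ℝ) ^ 2)⁻¹ := by
  simp_rw [eqInd_mul_inv_card_missed hxy]
  exact expect_mul_eqInd_symm hxy fun g b => by
    simp only [missedOff_update (mem_singleton_self y)]

omit [Nonempty β] in
theorem card_missedOff_empty_le (S : Finset ι) (f : ι → β) :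
    ((missedOff ∅ f).card : ℝ) ≤ (missedOff S f).card := by
  exact_mod_cast card_le_card (missedOff_mono (empty_subset S) f)

omit [Nonempty β] in
theorem expect_inv_missedOff_le {a : ℝ} (ha : 0 < a)
    (h : ∀ f : ι → β, a ≤ (missedOff ∅ f).card) (y : ι) :
    𝔼 f : ι → β, (((missedOff {y} f).card : ℝ) ^ 2)⁻¹ ≤
      𝔼 f : ι → β, (((missedOff ∅ f).card : ℝ) ^ 2)⁻¹ := by
  refine Finset.expect_le_expect fun f _ => ?_
  have := ha.trans_le (h f)
  have := card_missedOff_empty_le {y} f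
  gcongr

theorem le_expect_inv_missedOff {a : ℝ} (ha : 0 < a)
    (h : ∀ f : ι → β, a ≤ (missedOff ∅ f).card) (y : ι) :
    𝔼 f : ι → β, (((missedOff ∅ f).card : ℝ) ^ 2)⁻¹ - 2 / a ^ 3 ≤
      𝔼 f : ι → β, (((missedOff {y} f).card : ℝ) ^ 2)⁻¹ := by
  have hc : 𝔼 _f : ι → β, 2 / a ^ 3 = 2 / a ^ 3 := Finset.expect_const univ_nonempty _
  rw [← hc, ← Finset.expect_sub_distrib]
  refine Finset.expect_le_expect fun f _ => ?_
  have hK := ha.trans_le (h f)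
  have h1 := card_missedOff_empty_le {y} f
  have h2 : ((missedOff {y} f).card : ℝ) ≤ (missedOff ∅ f).card + 1 := by
    exact_mod_cast card_missedOff_singleton_le y f
  have haK := h f
  set K : ℝ := ((missedOff ∅ f).card : ℝ)
  set L : ℝ := ((missedOff {y} f).card : ℝ)
  have h3 : ((K + 1) ^ 2)⁻¹ ≤ (L ^ 2)⁻¹ := by
    have : 0 < L := hK.trans_le h1
    gcongr
  have h4 : 2 / K ^ 3 ≤ 2 / a ^ 3 := by gcongr
  have h5 : (K ^ 2)⁻¹ - ((K + 1) ^ 2)⁻¹ ≤ 2 / K ^ 3 := by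
    rw [inv_sub_inv (by positivity) (by positivity),
      div_le_div_iff₀ (by positivity) (by positivity)]
    have : 0 < K ^ 2 := by positivity
    nlinarith [mul_pos this hK]
  linarith

theorem expect_disjoint_collisions_le {a : ℝ} (ha : 0 < a)
    (h : ∀ f : ι → β, a ≤ (missedOff ∅ f).card) {x y x' y' : ι} (hxy : x ≠ y) (hxy' : x' ≠ y')
    (hxy'' : x ≠ y') (hyy : y ≠ y') :
    𝔼 f : ι → β, eqInd (f x) (f y) * eqInd (f x') (f y') * (((missedOff ∅ f).card : ℝ) ^ 2)⁻¹ ^ 2 ≤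
      (Fintype.card β : ℝ)⁻¹ ^ 2 * 𝔼 f : ι → β, (((missedOff ∅ f).card : ℝ) ^ 2)⁻¹ ^ 2 := by
  have hpt : ∀ f : ι → β,
      eqInd (f x) (f y) * eqInd (f x') (f y') * (((missedOff ∅ f).card : ℝ) ^ 2)⁻¹ ^ 2 =
      (((missedOff {y, y'} f).card : ℝ) ^ 2)⁻¹ ^ 2 * eqInd (f x) (f y) * eqInd (f x') (f y') := by
    intro f
    by_cases h1 : f x = f y
    · by_cases h2 : f x' = f y'
      · rw [missedOff_insert (S := {y'}) hxy (by simpa using hxy'') h1.symm,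
          ← insert_empty_eq, missedOff_insert hxy' (by simp) h2.symm]
        ring
      · rw [eqInd_of_ne h2]; ring
    · rw [eqInd_of_ne h1]; ring
  simp_rw [hpt]
  rw [expect_mul_eqInd_symm hxy', expect_mul_eqInd_symm hxy, ← mul_assoc, ← sq]
  · refine mul_le_mul_of_nonneg_left (Finset.expect_le_expect fun f _ => ?_) (by positivity)
    have := ha.trans_le (h f)
    have := card_missedOff_empty_le {y, y'} f
    gcongr
  · intro g b
    simp only [missedOff_update (S := {y, y'}) (i := y) (by simp)]
  · intro g b
    simp only [missedOff_update (S := {y, y'}) (i := y') (by simp),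
      Function.update_of_ne hxy'', Function.update_of_ne hyy]

/-- Covariance bound for two disjoint pairs of collisions. -/
theorem disjoint_collisions_cov_le {a : ℝ} (ha : 0 < a)
    (h : ∀ f : ι → β, a ≤ (missedOff ∅ f).card) {x y x' y' : ι} (hxy : x ≠ y) (hxy' : x' ≠ y')
    (hxy'' : x ≠ y') (hyy : y ≠ y') :
    𝔼 f : ι → β, eqInd (f x) (f y) * eqInd (f x') (f y') * (((missedOff ∅ f).card : ℝ) ^ 2)⁻¹ ^ 2 -
      (𝔼 f : ι → β, eqInd (f x) (f y) * (((missedOff ∅ f).card : ℝ) ^ 2)⁻¹) *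
      (𝔼 f : ι → β, eqInd (f x') (f y') * (((missedOff ∅ f).card : ℝ) ^ 2)⁻¹) ≤
      (Fintype.card β : ℝ)⁻¹ ^ 2 * (4 * (Fintype.card β : ℝ) ^ 3 / a ^ 8 + 4 / a ^ 5) := by
  have h1 := expect_disjoint_collisions_le ha h hxy hxy' hxy'' hyy
  have h2 := variance_inv_missed_sq_le ha h
  have hp1 := expect_inv_missedOff_le ha h y
  have hq1 := expect_inv_missedOff_le ha h y'
  have hp2 := le_expect_inv_missedOff ha h y
  have hq2 := le_expect_inv_missedOff ha h y'
  rw [expect_collision_mul_inv hxy, expect_collision_mul_inv hxy']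
  have hp0 : 0 ≤ 𝔼 f : ι → β, (((missedOff {y} f).card : ℝ) ^ 2)⁻¹ :=
    Finset.expect_nonneg fun f _ => by positivity
  have hu : 𝔼 f : ι → β, (((missedOff ∅ f).card : ℝ) ^ 2)⁻¹ ≤ (a ^ 2)⁻¹ :=
    Finset.expect_le univ_nonempty fun f _ => by have := h f; gcongr
  set u := 𝔼 f : ι → β, (((missedOff ∅ f).card : ℝ) ^ 2)⁻¹
  set p := 𝔼 f : ι → β, (((missedOff {y} f).card : ℝ) ^ 2)⁻¹
  set q := 𝔼 f : ι → β, (((missedOff {y'} f).card : ℝ) ^ 2)⁻¹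
  set V := 𝔼 f : ι → β, (((missedOff ∅ f).card : ℝ) ^ 2)⁻¹ ^ 2
  have hε : 0 ≤ 2 / a ^ 3 := by positivity
  have e1 : u * (u - p) ≤ (a ^ 2)⁻¹ * (2 / a ^ 3) :=
    mul_le_mul hu (by linarith) (by linarith) (by positivity)
  have e2 : p * (u - q) ≤ (a ^ 2)⁻¹ * (2 / a ^ 3) :=
    mul_le_mul (hp1.trans hu) (by linarith) (by linarith) (by positivity)
  have e3 : (a ^ 2)⁻¹ * (2 / a ^ 3) = 2 / a ^ 5 := by field_simp
  have e4 : 4 / a ^ 5 = 2 * (2 / a ^ 5) := by ring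
  have e5 : V - p * q ≤ 4 * (Fintype.card β : ℝ) ^ 3 / a ^ 8 + 4 / a ^ 5 := by
    rw [e4]; rw [e3] at e1 e2; nlinarith
  have e6 := mul_le_mul_of_nonneg_left e5 (sq_nonneg (Fintype.card β : ℝ)⁻¹)
  nlinarith

end Collisions

section Matching

variable {α γ β : Type*} [Fintype α] [Fintype γ] [DecidableEq α] [DecidableEq γ]
  [Fintype β] [Nonempty β]

theorem expect_match {a b : α} (hab : a ≠ b) (p q : γ) :
    𝔼 g : α ⊕ γ → β, eqInd (g (.inl a)) (g (.inr p)) * eqInd (g (.inl b)) (g (.inr q)) =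
      (Fintype.card β : ℝ)⁻¹ ^ 2 := by
  rw [expect_mul_eqInd, expect_eqInd_apply, sq]
  · simp
  · simp
  · exact indep_eqInd (by simpa using hab) (by simp)

theorem expect_match_disjoint {a b a' b' : α} (hab : a ≠ b) (hab' : a' ≠ b')
    (haa : a ≠ a') (h1 : a ≠ b') (h2 : b ≠ a') (hbb : b ≠ b') (p q p' q' : γ) :
    𝔼 g : α ⊕ γ → β, eqInd (g (.inl a)) (g (.inr p)) * eqInd (g (.inl b)) (g (.inr q)) *
      (eqInd (g (.inl a')) (g (.inr p')) * eqInd (g (.inl b')) (g (.inr q'))) =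
      ((Fintype.card β : ℝ) ^ 2)⁻¹ ^ 2 := by
  simp_rw [← mul_assoc]
  rw [expect_mul_eqInd, expect_mul_eqInd, expect_match hab, inv_pow]
  · ring
  · simp
  · exact (indep_eqInd (by simpa using haa) (by simp)).mul
      (indep_eqInd (by simpa using h2) (by simp))
  · simp
  · exact ((indep_eqInd (by simpa using h1) (by simp)).mul
      (indep_eqInd (by simpa using hbb) (by simp))).mul
      (indep_eqInd (by simpa using hab') (by simp))

theorem expect_match_star_le {a b b' : α} (hab : a ≠ b) (hab' : a ≠ b') (hbb' : b ≠ b')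
    (p p' q q' : γ) :
    𝔼 g : α ⊕ γ → β, eqInd (g (.inl a)) (g (.inr p)) * eqInd (g (.inl a)) (g (.inr p')) *
      eqInd (g (.inl b)) (g (.inr q)) * eqInd (g (.inl b')) (g (.inr q')) ≤
      (Fintype.card β : ℝ)⁻¹ ^ 4 + eqInd p p' * (Fintype.card β : ℝ)⁻¹ ^ 3 := by
  rw [expect_mul_eqInd, expect_mul_eqInd]
  · by_cases hp : p = p'
    · subst hp
      simp_rw [eqInd_mul_self]
      rw [expect_eqInd_apply (by simp), eqInd_self]
      have : 0 ≤ (Fintype.card β : ℝ)⁻¹ ^ 4 := by positivity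
      linarith [show (Fintype.card β : ℝ)⁻¹ * ((Fintype.card β : ℝ)⁻¹ * (Fintype.card β : ℝ)⁻¹) =
        (Fintype.card β : ℝ)⁻¹ ^ 3 by ring]
    · rw [expect_two_collisions (by simp) (by simp) (by simpa using hp), eqInd_of_ne hp]
      exact le_of_eq (by ring)
  · simp
  · exact (indep_eqInd (by simpa using hab) (by simp)).mul
      (indep_eqInd (by simpa using hab) (by simp))
  · simp
  · exact ((indep_eqInd (by simpa using hab') (by simp)).mul
      (indep_eqInd (by simpa using hab') (by simp))).mul
      (indep_eqInd (by simpa using hbb') (by simp))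

theorem expect_match_three {a b : α} (hab : a ≠ b) (p : γ) {q q' : γ} (hq : q ≠ q') :
    𝔼 g : α ⊕ γ → β, eqInd (g (.inl b)) (g (.inr q)) * eqInd (g (.inl b)) (g (.inr q')) *
      eqInd (g (.inl a)) (g (.inr p)) = (Fintype.card β : ℝ)⁻¹ ^ 3 := by
  rw [expect_mul_eqInd, expect_two_collisions (by simp) (by simp) (by simpa using hq)]
  · ring
  · simp
  · exact (indep_eqInd (by simpa using hab.symm) (by simp)).mul
      (indep_eqInd (by simpa using hab.symm) (by simp))

theorem expect_match_four {a b : α} (hab : a ≠ b) {p p' q q' : γ} (hp : p ≠ p') (hq : q ≠ q')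
    (h1 : q ≠ p') (h2 : q' ≠ p') :
    𝔼 g : α ⊕ γ → β, eqInd (g (.inl b)) (g (.inr q)) * eqInd (g (.inl b)) (g (.inr q')) *
      eqInd (g (.inl a)) (g (.inr p)) * eqInd (g (.inl a)) (g (.inr p')) =
      (Fintype.card β : ℝ)⁻¹ ^ 4 := by
  rw [expect_mul_eqInd_symm, expect_match_three hab p hq]
  · ring
  · simp
  · exact ((indep_eqInd (by simp) (by simpa using h1)).mul
      (indep_eqInd (by simp) (by simpa using h2))).mul
      (indep_eqInd (by simp) (by simpa using hp))

theorem expect_match_double_le {a b : α} (hab : a ≠ b) {p p' q q' : γ} (hpq : p ≠ q)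
    (hpq' : p' ≠ q') :
    𝔼 g : α ⊕ γ → β, eqInd (g (.inl a)) (g (.inr p)) * eqInd (g (.inl b)) (g (.inr q)) *
      (eqInd (g (.inl a)) (g (.inr p')) * eqInd (g (.inl b)) (g (.inr q'))) ≤
      (Fintype.card β : ℝ)⁻¹ ^ 4 + (eqInd p p' + eqInd q q' + eqInd p q' * eqInd q p') *
        (Fintype.card β : ℝ)⁻¹ ^ 3 + eqInd p p' * eqInd q q' * (Fintype.card β : ℝ)⁻¹ ^ 2 := by
  have n2 : 0 ≤ (Fintype.card β : ℝ)⁻¹ ^ 2 := by positivity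
  have n3 : 0 ≤ (Fintype.card β : ℝ)⁻¹ ^ 3 := by positivity
  have n4 : 0 ≤ (Fintype.card β : ℝ)⁻¹ ^ 4 := by positivity
  have nn := mul_nonneg (mul_nonneg (eqInd_nonneg p q') (eqInd_nonneg q p')) n3
  have np := mul_nonneg (eqInd_nonneg p p') n3
  have nq := mul_nonneg (eqInd_nonneg q q') n3
  by_cases hp : p = p'
  · subst hp
    by_cases hq : q = q'
    · subst hq
      simp_rw [← sq, sq, mul_mul_mul_comm, eqInd_mul_self]
      rw [expect_match hab]
      simp only [eqInd_self] at *
      linarith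
    · have h := expect_match_three (β := β) hab p hq
      have e : ∀ g : α ⊕ γ → β, eqInd (g (.inl a)) (g (.inr p)) *
          eqInd (g (.inl b)) (g (.inr q)) *
          (eqInd (g (.inl a)) (g (.inr p)) * eqInd (g (.inl b)) (g (.inr q'))) =
          eqInd (g (.inl b)) (g (.inr q)) * eqInd (g (.inl b)) (g (.inr q')) *
          eqInd (g (.inl a)) (g (.inr p)) := fun g => by
        linear_combination (eqInd (g (.inl b)) (g (.inr q)) * eqInd (g (.inl b)) (g (.inr q'))) *
          eqInd_mul_self (g (.inl a)) (g (.inr p))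
      simp_rw [e]
      rw [h]
      simp only [eqInd_self, eqInd_of_ne hq] at *
      linarith
  by_cases hq : q = q'
  · subst hq
    have h := expect_match_three (β := β) hab.symm q hp
    have e : ∀ g : α ⊕ γ → β, eqInd (g (.inl a)) (g (.inr p)) *
        eqInd (g (.inl b)) (g (.inr q)) *
        (eqInd (g (.inl a)) (g (.inr p')) * eqInd (g (.inl b)) (g (.inr q))) =
        eqInd (g (.inl a)) (g (.inr p)) * eqInd (g (.inl a)) (g (.inr p')) *
        eqInd (g (.inl b)) (g (.inr q)) := fun g => by
      linear_combination (eqInd (g (.inl a)) (g (.inr p)) * eqInd (g (.inl a)) (g (.inr p'))) *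
        eqInd_mul_self (g (.inl b)) (g (.inr q))
    simp_rw [e]
    rw [h]
    simp only [eqInd_self, eqInd_of_ne hp] at *
    linarith
  rw [eqInd_of_ne hp, eqInd_of_ne hq]
  by_cases h1 : p' = q
  · by_cases h2 : p = q'
    · subst h1 h2
      have h := expect_match_three (β := β) hab p hq
      have e : 𝔼 g : α ⊕ γ → β, eqInd (g (.inl a)) (g (.inr p)) *
          eqInd (g (.inl b)) (g (.inr p')) *
          (eqInd (g (.inl a)) (g (.inr p')) * eqInd (g (.inl b)) (g (.inr p))) ≤
          𝔼 g : α ⊕ γ → β, eqInd (g (.inl b)) (g (.inr p')) * eqInd (g (.inl b)) (g (.inr p)) *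
          eqInd (g (.inl a)) (g (.inr p)) := Finset.expect_le_expect fun g _ => by
        have := mul_le_mul_of_nonneg_left (eqInd_le_one (g (.inl a)) (g (.inr p')))
          (mul_nonneg (mul_nonneg (eqInd_nonneg (g (.inl b)) (g (.inr p')))
            (eqInd_nonneg (g (.inl b)) (g (.inr p)))) (eqInd_nonneg (g (.inl a)) (g (.inr p))))
        linarith
      rw [h] at e
      simp only [eqInd_self]
      linarith
    · have hqp : q ≠ p := hpq.symm
      have h := expect_match_four (β := β) hab (Ne.symm hp) hq hqp (Ne.symm h2)
      have e : ∀ g : α ⊕ γ → β, eqInd (g (.inl a)) (g (.inr p)) *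
          eqInd (g (.inl b)) (g (.inr q)) *
          (eqInd (g (.inl a)) (g (.inr p')) * eqInd (g (.inl b)) (g (.inr q'))) =
          eqInd (g (.inl b)) (g (.inr q)) * eqInd (g (.inl b)) (g (.inr q')) *
          eqInd (g (.inl a)) (g (.inr p')) * eqInd (g (.inl a)) (g (.inr p)) :=
        fun g => by ring
      simp_rw [e]
      rw [h]
      linarith
  · have h := expect_match_four (β := β) hab hp hq (Ne.symm h1) hpq'.symm
    have e : ∀ g : α ⊕ γ → β, eqInd (g (.inl a)) (g (.inr p)) *
        eqInd (g (.inl b)) (g (.inr q)) *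
        (eqInd (g (.inl a)) (g (.inr p')) * eqInd (g (.inl b)) (g (.inr q'))) =
        eqInd (g (.inl b)) (g (.inr q)) * eqInd (g (.inl b)) (g (.inr q')) *
        eqInd (g (.inl a)) (g (.inr p)) * eqInd (g (.inl a)) (g (.inr p')) :=
      fun g => by ring
    simp_rw [e]
    rw [h]
    linarith

end Matching

section Covariance

variable {n1 n2 m : ℕ}

theorem Zind_eq (v : Fin n1 × Fin n1 × Fin n2 × Fin n2) (ω : FSSpace n1 n2 m) :
    Zind v ω = eqInd (fOne ω v.1) (fOne ω v.2.1) *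
      (eqInd (sOne ω v.1) (fTwo ω v.2.2.1) * eqInd (sOne ω v.2.1) (fTwo ω v.2.2.2)) := by
  unfold Zind ZEvent eqInd
  split_ifs <;> simp_all

theorem le_card_missedOff (f : Fin n1 → Fin m) :
    (m : ℝ) - n1 ≤ ((missedOff ∅ f).card : ℝ) := by
  rw [← card_missedOff_empty, card_missed]
  have h2 := card_image_le (s := univ) (f := f)
  simp only [card_univ, Fintype.card_fin] at h2
  have h3 : ((univ.image f).card : ℝ) ≤ n1 := by exact_mod_cast h2
  linarith

theorem missed_nonempty (h : n1 + n2 < m) (f : Fin n1 → Fin m) : Nonempty (Missed f) := by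
  have h1 := le_card_missedOff f
  have h2 : (n1 : ℝ) < m := by exact_mod_cast (by omega : n1 < m)
  rw [← card_missedOff_empty] at h1
  have h3 : (0 : ℝ) < Fintype.card (Missed f) := by linarith
  exact Fintype.card_pos_iff.1 (by exact_mod_cast h3)

theorem eqInd_val {α : Type*} {P : α → Prop} (a b : {x // P x}) : eqInd a.1 b.1 = eqInd a b := by
  simp [eqInd, Subtype.ext_iff]

theorem fsExp_Zind (h : n1 + n2 < m) {v : Fin n1 × Fin n1 × Fin n2 × Fin n2}
    (hv : v ∈ Ttup n1 n2) :
    fsExp n1 n2 m (Zind v) = 𝔼 f : Fin n1 → Fin m,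
      eqInd (f v.1) (f v.2.1) * (((missedOff ∅ f).card : ℝ) ^ 2)⁻¹ := by
  simp only [Ttup, mem_filter, mem_univ, true_and] at hv
  have := fsExp_eq_expect h fun f s k => eqInd (f v.1) (f v.2.1) *
    (eqInd (s v.1) (k v.2.2.1) * eqInd (s v.2.1) (k v.2.2.2))
  rw [show Zind v = fun ω => _ from funext (Zind_eq (m := m) v), this]
  refine Finset.expect_congr rfl fun f _ => ?_
  have := missed_nonempty h f
  rw [← Finset.mul_expect]
  simp only [eqInd_val]
  rw [expect_match hv.1.ne, card_missedOff_empty, inv_pow]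

theorem fsExp_Zind_mul (h : n1 + n2 < m) (v w : Fin n1 × Fin n1 × Fin n2 × Fin n2) :
    fsExp n1 n2 m (fun ω => Zind v ω * Zind w ω) = 𝔼 f : Fin n1 → Fin m,
      eqInd (f v.1) (f v.2.1) * eqInd (f w.1) (f w.2.1) *
        𝔼 g : Fin n1 ⊕ Fin n2 → Missed f,
          eqInd (g (.inl v.1)) (g (.inr v.2.2.1)) * eqInd (g (.inl v.2.1)) (g (.inr v.2.2.2)) *
          (eqInd (g (.inl w.1)) (g (.inr w.2.2.1)) *
            eqInd (g (.inl w.2.1)) (g (.inr w.2.2.2))) := by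
  have := fsExp_eq_expect h fun f s k => eqInd (f v.1) (f v.2.1) * eqInd (f w.1) (f w.2.1) *
    (eqInd (s v.1) (k v.2.2.1) * eqInd (s v.2.1) (k v.2.2.2) *
      (eqInd (s w.1) (k w.2.2.1) * eqInd (s w.2.1) (k w.2.2.2)))
  simp only [Zind_eq, mul_mul_mul_comm (eqInd (fOne _ v.1) _) _ (eqInd (fOne _ w.1) _) _]
  rw [this]
  refine Finset.expect_congr rfl fun f _ => ?_
  rw [← Finset.mul_expect]
  simp only [eqInd_val]

theorem expect_mul_le_mul {κ : Type*} [Fintype κ] {A G : κ → ℝ} {q D : ℝ}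
    (hA : ∀ i, 0 ≤ A i) (hG : ∀ i, G i ≤ D) (hD : 0 ≤ D) (hq : 𝔼 i, A i ≤ q) :
    𝔼 i, A i * G i ≤ q * D := by
  calc 𝔼 i, A i * G i ≤ 𝔼 i, A i * D :=
        Finset.expect_le_expect fun i _ => mul_le_mul_of_nonneg_left (hG i) (hA i)
    _ = (𝔼 i, A i) * D := (Finset.expect_mul _ _ _).symm
    _ ≤ q * D := mul_le_mul_of_nonneg_right hq hD

/-- The bound for pairs of tuples sharing exactly one first-category applicant. -/
theorem expect_share_one_le (h : n1 + n2 < m) {ρ : ℝ} (hm : (m : ℝ)⁻¹ ≤ ρ)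
    (hρ : ∀ f : Fin n1 → Fin m, ((missedOff ∅ f).card : ℝ)⁻¹ ≤ ρ)
    {a b b' : Fin n1} (hab : a ≠ b) (hab' : a ≠ b') (hbb' : b ≠ b') (p p' q q' : Fin n2) :
    𝔼 f : Fin n1 → Fin m, eqInd (f a) (f b) * eqInd (f a) (f b') *
      𝔼 g : Fin n1 ⊕ Fin n2 → Missed f,
        eqInd (g (.inl a)) (g (.inr p)) * eqInd (g (.inl a)) (g (.inr p')) *
          eqInd (g (.inl b)) (g (.inr q)) * eqInd (g (.inl b')) (g (.inr q')) ≤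
      ρ ^ 6 + eqInd p p' * ρ ^ 5 := by
  have : Nonempty (Fin m) := ⟨⟨0, by omega⟩⟩
  have hm0 : (0 : ℝ) ≤ (m : ℝ)⁻¹ := by positivity
  have hρ0 : 0 ≤ ρ := hm0.trans hm
  have he := eqInd_nonneg p p'
  have : ρ ^ 6 + eqInd p p' * ρ ^ 5 = ρ ^ 2 * (ρ ^ 4 + eqInd p p' * ρ ^ 3) := by ring
  rw [this]
  refine expect_mul_le_mul (fun f => mul_nonneg (eqInd_nonneg _ _) (eqInd_nonneg _ _))
    (fun f => ?_) (by positivity) ?_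
  · have := missed_nonempty h f
    have hf := hρ f
    rw [← card_missedOff_empty] at hf
    refine (expect_match_star_le hab hab' hbb' p p' q q').trans ?_
    gcongr
  · rw [expect_two_collisions hab hab' hbb', Fintype.card_fin]
    gcongr

/-- The bound for pairs of tuples sharing both first-category applicants. -/
theorem expect_share_two_le (h : n1 + n2 < m) {ρ : ℝ} (hm : (m : ℝ)⁻¹ ≤ ρ)
    (hρ : ∀ f : Fin n1 → Fin m, ((missedOff ∅ f).card : ℝ)⁻¹ ≤ ρ)
    {a b : Fin n1} (hab : a ≠ b) {p p' q q' : Fin n2} (hpq : p ≠ q) (hpq' : p' ≠ q') :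
    𝔼 f : Fin n1 → Fin m, eqInd (f a) (f b) * eqInd (f a) (f b) *
      𝔼 g : Fin n1 ⊕ Fin n2 → Missed f,
        eqInd (g (.inl a)) (g (.inr p)) * eqInd (g (.inl b)) (g (.inr q)) *
          (eqInd (g (.inl a)) (g (.inr p')) * eqInd (g (.inl b)) (g (.inr q'))) ≤
      ρ ^ 5 + (eqInd p p' + eqInd q q' + eqInd p q' * eqInd q p') * ρ ^ 4 +
        eqInd p p' * eqInd q q' * ρ ^ 3 := by
  have : Nonempty (Fin m) := ⟨⟨0, by omega⟩⟩
  have hm0 : (0 : ℝ) ≤ (m : ℝ)⁻¹ := by positivity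
  have hρ0 : 0 ≤ ρ := hm0.trans hm
  have h1 := eqInd_nonneg p p'
  have h2 := eqInd_nonneg q q'
  have h3 := eqInd_nonneg p q'
  have h4 := eqInd_nonneg q p'
  have : ρ ^ 5 + (eqInd p p' + eqInd q q' + eqInd p q' * eqInd q p') * ρ ^ 4 +
      eqInd p p' * eqInd q q' * ρ ^ 3 = ρ * (ρ ^ 4 +
      (eqInd p p' + eqInd q q' + eqInd p q' * eqInd q p') * ρ ^ 3 +
      eqInd p p' * eqInd q q' * ρ ^ 2) := by ring
  rw [this]
  refine expect_mul_le_mul (fun f => mul_nonneg (eqInd_nonneg _ _) (eqInd_nonneg _ _))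
    (fun f => ?_) (by positivity) ?_
  · have := missed_nonempty h f
    have hf := hρ f
    rw [← card_missedOff_empty] at hf
    refine (expect_match_double_le hab hpq hpq').trans ?_
    gcongr
  · simp_rw [eqInd_mul_self]
    rwa [expect_eqInd_apply hab, Fintype.card_fin]

/-- An upper bound, up to a constant factor, for the covariance of `Z_v` and `Z_w`. -/
def covBound (ρ : ℝ) (v w : Fin n1 × Fin n1 × Fin n2 × Fin n2) : ℝ :=
  ρ ^ 7 + eqInd v.1 w.1 * (ρ ^ 6 + eqInd v.2.2.1 w.2.2.1 * ρ ^ 5) +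
    eqInd v.1 w.2.1 * (ρ ^ 6 + eqInd v.2.2.1 w.2.2.2 * ρ ^ 5) +
    eqInd v.2.1 w.1 * (ρ ^ 6 + eqInd v.2.2.2 w.2.2.1 * ρ ^ 5) +
    eqInd v.2.1 w.2.1 * (ρ ^ 6 + eqInd v.2.2.2 w.2.2.2 * ρ ^ 5) +
    eqInd v.1 w.1 * eqInd v.2.1 w.2.1 *
      (ρ ^ 5 + (eqInd v.2.2.1 w.2.2.1 + eqInd v.2.2.2 w.2.2.2 +
        eqInd v.2.2.1 w.2.2.2 * eqInd v.2.2.2 w.2.2.1) * ρ ^ 4 +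
        eqInd v.2.2.1 w.2.2.1 * eqInd v.2.2.2 w.2.2.2 * ρ ^ 3)

theorem sum_eqInd {α : Type*} [Fintype α] (i : α) : ∑ j, eqInd i j = 1 := by
  simp [eqInd]

theorem sum_covBound_eq (ρ : ℝ) (v : Fin n1 × Fin n1 × Fin n2 × Fin n2) :
    ∑ w, covBound ρ v w = ρ ^ 7 * (n1 ^ 2 * n2 ^ 2) + 4 * (ρ ^ 6 * (n1 * n2 ^ 2)) +
      4 * (ρ ^ 5 * (n1 * n2)) + ρ ^ 5 * n2 ^ 2 + 2 * (ρ ^ 4 * n2) + ρ ^ 4 + ρ ^ 3 := by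
  have key : ∀ (r : ℝ) (a b : Fin n1 → ℝ) (c d : Fin n2 → ℝ),
      ∑ w : Fin n1 × Fin n1 × Fin n2 × Fin n2, r * (a w.1 * b w.2.1 * (c w.2.2.1 * d w.2.2.2)) =
        r * ((∑ i, a i) * (∑ i, b i) * ((∑ i, c i) * ∑ i, d i)) := by
    intro r a b c d
    simp only [Fintype.sum_prod_type, ← Finset.mul_sum, ← Finset.sum_mul]
  obtain ⟨x, x', y, y'⟩ := v
  have hexp : ∀ w : Fin n1 × Fin n1 × Fin n2 × Fin n2, covBound ρ (x, x', y, y') w =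
      ρ ^ 7 * (1 * 1 * (1 * 1)) +
      ρ ^ 6 * (eqInd x w.1 * 1 * (1 * 1)) + ρ ^ 5 * (eqInd x w.1 * 1 * (eqInd y w.2.2.1 * 1)) +
      ρ ^ 6 * (1 * eqInd x w.2.1 * (1 * 1)) + ρ ^ 5 * (1 * eqInd x w.2.1 * (1 * eqInd y w.2.2.2)) +
      ρ ^ 6 * (eqInd x' w.1 * 1 * (1 * 1)) + ρ ^ 5 * (eqInd x' w.1 * 1 * (eqInd y' w.2.2.1 * 1)) +
      ρ ^ 6 * (1 * eqInd x' w.2.1 * (1 * 1)) +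
      ρ ^ 5 * (1 * eqInd x' w.2.1 * (1 * eqInd y' w.2.2.2)) +
      ρ ^ 5 * (eqInd x w.1 * eqInd x' w.2.1 * (1 * 1)) +
      ρ ^ 4 * (eqInd x w.1 * eqInd x' w.2.1 * (eqInd y w.2.2.1 * 1)) +
      ρ ^ 4 * (eqInd x w.1 * eqInd x' w.2.1 * (1 * eqInd y' w.2.2.2)) +
      ρ ^ 4 * (eqInd x w.1 * eqInd x' w.2.1 * (eqInd y' w.2.2.1 * eqInd y w.2.2.2)) +
      ρ ^ 3 * (eqInd x w.1 * eqInd x' w.2.1 * (eqInd y w.2.2.1 * eqInd y' w.2.2.2)) := by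
    intro w
    simp only [covBound]
    ring
  simp only [hexp, Finset.sum_add_distrib]
  rw [key (ρ ^ 7) (fun _ => 1) (fun _ => 1) (fun _ => 1) (fun _ => 1),
    key (ρ ^ 6) (eqInd x) (fun _ => 1) (fun _ => 1) (fun _ => 1),
    key (ρ ^ 5) (eqInd x) (fun _ => 1) (eqInd y) (fun _ => 1),
    key (ρ ^ 6) (fun _ => 1) (eqInd x) (fun _ => 1) (fun _ => 1),
    key (ρ ^ 5) (fun _ => 1) (eqInd x) (fun _ => 1) (eqInd y),
    key (ρ ^ 6) (eqInd x') (fun _ => 1) (fun _ => 1) (fun _ => 1),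
    key (ρ ^ 5) (eqInd x') (fun _ => 1) (eqInd y') (fun _ => 1),
    key (ρ ^ 6) (fun _ => 1) (eqInd x') (fun _ => 1) (fun _ => 1),
    key (ρ ^ 5) (fun _ => 1) (eqInd x') (fun _ => 1) (eqInd y'),
    key (ρ ^ 5) (eqInd x) (eqInd x') (fun _ => 1) (fun _ => 1),
    key (ρ ^ 4) (eqInd x) (eqInd x') (eqInd y) (fun _ => 1),
    key (ρ ^ 4) (eqInd x) (eqInd x') (fun _ => 1) (eqInd y'),
    key (ρ ^ 4) (eqInd x) (eqInd x') (eqInd y') (eqInd y),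
    key (ρ ^ 3) (eqInd x) (eqInd x') (eqInd y) (eqInd y')]
  simp only [sum_eqInd, Finset.sum_const, card_univ, Fintype.card_fin, nsmul_eq_mul, mul_one]
  ring

theorem sum_covBound_le {ρ c : ℝ} (hρ : 0 ≤ ρ) (hc : 1 ≤ c) (hρc : ρ ≤ c) (h1 : n1 * ρ ≤ c)
    (h2 : n2 * ρ ≤ c) (v : Fin n1 × Fin n1 × Fin n2 × Fin n2) :
    ∑ w, covBound ρ v w ≤ 14 * c ^ 4 * ρ ^ 3 := by
  rw [sum_covBound_eq]
  have e : ρ ^ 7 * (n1 ^ 2 * n2 ^ 2) + 4 * (ρ ^ 6 * (n1 * n2 ^ 2)) +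
      4 * (ρ ^ 5 * (n1 * n2)) + ρ ^ 5 * n2 ^ 2 + 2 * (ρ ^ 4 * n2) + ρ ^ 4 + ρ ^ 3 =
      ((n1 * ρ) ^ 2 * (n2 * ρ) ^ 2 + 4 * ((n1 * ρ) * (n2 * ρ) ^ 2) + 4 * ((n1 * ρ) * (n2 * ρ)) +
        (n2 * ρ) ^ 2 + 2 * (n2 * ρ) + ρ + 1) * ρ ^ 3 := by ring
  rw [e]
  refine mul_le_mul_of_nonneg_right ?_ (by positivity)
  have p1 : (1 : ℝ) ≤ c ^ 4 := one_le_pow₀ hc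
  have p2 : c ≤ c ^ 4 := le_self_pow₀ hc (by norm_num)
  have p3 : c ^ 2 ≤ c ^ 4 := pow_le_pow_right₀ hc (by norm_num)
  have p4 : c ^ 3 ≤ c ^ 4 := pow_le_pow_right₀ hc (by norm_num)
  have hx : 0 ≤ (n1 : ℝ) * ρ := by positivity
  have hy : 0 ≤ (n2 : ℝ) * ρ := by positivity
  have q1 : ((n1 : ℝ) * ρ) ^ 2 * (n2 * ρ) ^ 2 ≤ c ^ 2 * c ^ 2 := by gcongr
  have q2 : ((n1 : ℝ) * ρ) * (n2 * ρ) ^ 2 ≤ c * c ^ 2 := by gcongr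
  have q3 : ((n1 : ℝ) * ρ) * (n2 * ρ) ≤ c * c := by gcongr
  have q4 : ((n2 : ℝ) * ρ) ^ 2 ≤ c ^ 2 := by gcongr
  nlinarith

theorem le_covBound {ρ : ℝ} (hρ : 0 ≤ ρ) (v w : Fin n1 × Fin n1 × Fin n2 × Fin n2) :
    ρ ^ 7 ≤ covBound ρ v w ∧
    eqInd v.1 w.1 * (ρ ^ 6 + eqInd v.2.2.1 w.2.2.1 * ρ ^ 5) ≤ covBound ρ v w ∧
    eqInd v.1 w.2.1 * (ρ ^ 6 + eqInd v.2.2.1 w.2.2.2 * ρ ^ 5) ≤ covBound ρ v w ∧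
    eqInd v.2.1 w.1 * (ρ ^ 6 + eqInd v.2.2.2 w.2.2.1 * ρ ^ 5) ≤ covBound ρ v w ∧
    eqInd v.2.1 w.2.1 * (ρ ^ 6 + eqInd v.2.2.2 w.2.2.2 * ρ ^ 5) ≤ covBound ρ v w ∧
    eqInd v.1 w.1 * eqInd v.2.1 w.2.1 *
      (ρ ^ 5 + (eqInd v.2.2.1 w.2.2.1 + eqInd v.2.2.2 w.2.2.2 +
        eqInd v.2.2.1 w.2.2.2 * eqInd v.2.2.2 w.2.2.1) * ρ ^ 4 +
        eqInd v.2.2.1 w.2.2.1 * eqInd v.2.2.2 w.2.2.2 * ρ ^ 3) ≤ covBound ρ v w := by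
  have hn := fun {α : Type} (i j : α) => eqInd_nonneg i j
  have := hn v.1 w.1
  have := hn v.1 w.2.1
  have := hn v.2.1 w.1
  have := hn v.2.1 w.2.1
  have := hn v.2.2.1 w.2.2.1
  have := hn v.2.2.1 w.2.2.2
  have := hn v.2.2.2 w.2.2.1
  have := hn v.2.2.2 w.2.2.2
  have t0 : 0 ≤ ρ ^ 7 := by positivity
  have t1 : 0 ≤ eqInd v.1 w.1 * (ρ ^ 6 + eqInd v.2.2.1 w.2.2.1 * ρ ^ 5) := by positivity
  have t2 : 0 ≤ eqInd v.1 w.2.1 * (ρ ^ 6 + eqInd v.2.2.1 w.2.2.2 * ρ ^ 5) := by positivity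
  have t3 : 0 ≤ eqInd v.2.1 w.1 * (ρ ^ 6 + eqInd v.2.2.2 w.2.2.1 * ρ ^ 5) := by positivity
  have t4 : 0 ≤ eqInd v.2.1 w.2.1 * (ρ ^ 6 + eqInd v.2.2.2 w.2.2.2 * ρ ^ 5) := by positivity
  have t5 : 0 ≤ eqInd v.1 w.1 * eqInd v.2.1 w.2.1 *
      (ρ ^ 5 + (eqInd v.2.2.1 w.2.2.1 + eqInd v.2.2.2 w.2.2.2 +
        eqInd v.2.2.1 w.2.2.2 * eqInd v.2.2.2 w.2.2.1) * ρ ^ 4 +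
        eqInd v.2.2.1 w.2.2.1 * eqInd v.2.2.2 w.2.2.2 * ρ ^ 3) := by positivity
  unfold covBound
  refine ⟨?_, ?_, ?_, ?_, ?_, ?_⟩ <;> linarith

theorem covBound_nonneg {ρ : ℝ} (hρ : 0 ≤ ρ) (v w : Fin n1 × Fin n1 × Fin n2 × Fin n2) :
    0 ≤ covBound ρ v w :=
  (pow_nonneg hρ 7).trans (le_covBound hρ v w).1

theorem fsExp_Zind_nonneg (h : n1 + n2 < m) {v : Fin n1 × Fin n1 × Fin n2 × Fin n2}
    (hv : v ∈ Ttup n1 n2) : 0 ≤ fsExp n1 n2 m (Zind v) := by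
  rw [fsExp_Zind h hv]
  exact Finset.expect_nonneg fun f _ => mul_nonneg (eqInd_nonneg _ _) (by positivity)

/-- Second-moment bound for tuples sharing a first-category applicant. -/
theorem fsExp_Zind_mul_le_of_common (h : n1 + n2 < m) {ρ : ℝ} (hm : (m : ℝ)⁻¹ ≤ ρ)
    (hρ : ∀ f : Fin n1 → Fin m, ((missedOff ∅ f).card : ℝ)⁻¹ ≤ ρ)
    {v w : Fin n1 × Fin n1 × Fin n2 × Fin n2} (hv : v ∈ Ttup n1 n2) (hw : w ∈ Ttup n1 n2)
    (hc : v.1 = w.1 ∨ v.1 = w.2.1 ∨ v.2.1 = w.1 ∨ v.2.1 = w.2.1) :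
    fsExp n1 n2 m (fun ω => Zind v ω * Zind w ω) ≤ covBound ρ v w := by
  have hρ0 : 0 ≤ ρ := le_trans (by positivity) hm
  have hbd := le_covBound hρ0 v w
  rw [fsExp_Zind_mul h]
  simp only [Ttup, mem_filter, mem_univ, true_and] at hv hw
  obtain ⟨x, z, y, u⟩ := v
  obtain ⟨x', z', y', u'⟩ := w
  obtain ⟨hxz, hyu⟩ := hv
  obtain ⟨hxz', hyu'⟩ := hw
  dsimp only at *
  obtain ⟨-, b1, b2, b3, b4, b5⟩ := hbd
  by_cases hd : x = x' ∧ z = z'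
  · obtain ⟨rfl, rfl⟩ := hd
    rw [eqInd_self, eqInd_self, one_mul, one_mul] at b5
    exact (expect_share_two_le h hm hρ hxz.ne hyu hyu').trans b5
  rcases hc with rfl | rfl | rfl | rfl
  · have hz : z ≠ z' := fun e => hd ⟨rfl, e⟩
    rw [eqInd_self, one_mul] at b1
    refine le_trans (le_of_eq ?_)
      ((expect_share_one_le h hm hρ hxz.ne hxz'.ne hz y y' u u').trans b1)
    refine Finset.expect_congr rfl fun f _ => ?_
    congr 1
    exact Finset.expect_congr rfl fun g _ => by ring
  · rw [eqInd_self, one_mul] at b2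
    refine le_trans (le_of_eq ?_)
      ((expect_share_one_le h hm hρ hxz.ne hxz'.ne' (hxz'.trans hxz).ne' y u' u y').trans b2)
    refine Finset.expect_congr rfl fun f _ => ?_
    rw [eqInd_comm (f x') (f x)]
    congr 1
    exact Finset.expect_congr rfl fun g _ => by ring
  · rw [eqInd_self, one_mul] at b3
    refine le_trans (le_of_eq ?_)
      ((expect_share_one_le h hm hρ hxz.ne' hxz'.ne (hxz.trans hxz').ne u y' y u').trans b3)
    refine Finset.expect_congr rfl fun f _ => ?_
    rw [eqInd_comm (f x) (f z)]
    congr 1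
    exact Finset.expect_congr rfl fun g _ => by ring
  · have hx : x ≠ x' := fun e => hd ⟨e, rfl⟩
    rw [eqInd_self, one_mul] at b4
    refine le_trans (le_of_eq ?_)
      ((expect_share_one_le h hm hρ hxz.ne' hxz'.ne' hx u u' y y').trans b4)
    refine Finset.expect_congr rfl fun f _ => ?_
    rw [eqInd_comm (f x) (f z), eqInd_comm (f x') (f z)]
    congr 1
    exact Finset.expect_congr rfl fun g _ => by ring

/-- Covariance bound for tuples with no first-category applicant in common. -/
theorem cov_le_of_disjoint (h : n1 + n2 < m) {a : ℝ} (ha : 0 < a)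
    (hK : ∀ f : Fin n1 → Fin m, a ≤ (missedOff ∅ f).card)
    {v w : Fin n1 × Fin n1 × Fin n2 × Fin n2} (hv : v ∈ Ttup n1 n2) (hw : w ∈ Ttup n1 n2)
    (h1 : v.1 ≠ w.1) (h2 : v.1 ≠ w.2.1) (h3 : v.2.1 ≠ w.1) (h4 : v.2.1 ≠ w.2.1) :
    fsExp n1 n2 m (fun ω => Zind v ω * Zind w ω) -
        fsExp n1 n2 m (Zind v) * fsExp n1 n2 m (Zind w) ≤
      (m : ℝ)⁻¹ ^ 2 * (4 * (m : ℝ) ^ 3 / a ^ 8 + 4 / a ^ 5) := by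
  have : Nonempty (Fin m) := ⟨⟨0, by omega⟩⟩
  rw [fsExp_Zind_mul h, fsExp_Zind h hv, fsExp_Zind h hw]
  simp only [Ttup, mem_filter, mem_univ, true_and] at hv hw
  have := disjoint_collisions_cov_le ha hK hv.1.ne hw.1.ne h2 h4
  rw [Fintype.card_fin] at this
  refine le_trans (le_of_eq ?_) this
  congr 1
  refine Finset.expect_congr rfl fun f _ => ?_
  have := missed_nonempty h f
  rw [expect_match_disjoint hv.1.ne hw.1.ne h1 h2 h3 h4, card_missedOff_empty]

theorem cov_le (h : n1 + n2 < m) {c : ℝ} (hc : 1 < c) (hmc : (m : ℝ) / c ≤ m - (n1 + n2 : ℕ))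
    {v w : Fin n1 × Fin n1 × Fin n2 × Fin n2} (hv : v ∈ Ttup n1 n2) (hw : w ∈ Ttup n1 n2) :
    fsExp n1 n2 m (fun ω => Zind v ω * Zind w ω) -
        fsExp n1 n2 m (Zind v) * fsExp n1 n2 m (Zind w) ≤ 8 * c * covBound (c / m) v w := by
  have hm : (0 : ℝ) < m := by exact_mod_cast (by omega : 0 < m)
  have hc0 : 0 < c := by linarith
  have hK : ∀ f : Fin n1 → Fin m, (m : ℝ) / c ≤ (missedOff ∅ f).card := fun f =>
    hmc.trans <| le_trans (by push_cast; linarith [n2.cast_nonneg (α := ℝ)]) (le_card_missedOff f)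
  have hcm : (m : ℝ)⁻¹ ≤ c / m := by
    rw [inv_eq_one_div]
    gcongr
  have hcov := covBound_nonneg (ρ := c / m) (by positivity) v w
  by_cases hcom : v.1 = w.1 ∨ v.1 = w.2.1 ∨ v.2.1 = w.1 ∨ v.2.1 = w.2.1
  · have hρ : ∀ f : Fin n1 → Fin m, ((missedOff ∅ f).card : ℝ)⁻¹ ≤ c / m := fun f => by
      rw [← inv_div]
      exact inv_anti₀ (by positivity) (hK f)
    have h1 := fsExp_Zind_mul_le_of_common h hcm hρ hv hw hcom
    have h2 := mul_nonneg (fsExp_Zind_nonneg h hv) (fsExp_Zind_nonneg h hw)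
    nlinarith
  · push Not at hcom
    refine (cov_le_of_disjoint h (by positivity) hK hv hw hcom.1 hcom.2.1 hcom.2.2.1
      hcom.2.2.2).trans ?_
    have e : (m : ℝ)⁻¹ ^ 2 * (4 * (m : ℝ) ^ 3 / (m / c) ^ 8 + 4 / (m / c) ^ 5) =
        4 * (c ^ 8 + c ^ 5) / m ^ 7 := by
      field_simp
    have h5 : c ^ 5 ≤ c ^ 8 := pow_le_pow_right₀ hc.le (by norm_num)
    calc _ = 4 * (c ^ 8 + c ^ 5) / m ^ 7 := e
      _ ≤ 4 * (c ^ 8 + c ^ 8) / m ^ 7 := by gcongr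
      _ = 8 * c * (c / m) ^ 7 := by field_simp; ring
      _ ≤ 8 * c * covBound (c / m) v w := by
        gcongr
        exact (le_covBound (by positivity) v w).1

theorem variance_Ztotal_eq :
    fsExp n1 n2 m (fun ω => Ztotal n1 n2 m ω ^ 2) - fsExp n1 n2 m (Ztotal n1 n2 m) ^ 2 =
      ∑ v ∈ Ttup n1 n2, ∑ w ∈ Ttup n1 n2, (fsExp n1 n2 m (fun ω => Zind v ω * Zind w ω) -
        fsExp n1 n2 m (Zind v) * fsExp n1 n2 m (Zind w)) := by
  have h1 : fsExp n1 n2 m (Ztotal n1 n2 m) = ∑ v ∈ Ttup n1 n2, fsExp n1 n2 m (Zind v) := by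
    simp only [fsExp, Ztotal, Finset.mul_sum]
    exact Finset.sum_comm
  have h2 : fsExp n1 n2 m (fun ω => Ztotal n1 n2 m ω ^ 2) =
      ∑ v ∈ Ttup n1 n2, ∑ w ∈ Ttup n1 n2, fsExp n1 n2 m (fun ω => Zind v ω * Zind w ω) := by
    simp only [fsExp, Ztotal, sq, Finset.sum_mul_sum]
    simp only [Finset.mul_sum]
    rw [Finset.sum_comm]
    exact Finset.sum_congr rfl fun v _ => Finset.sum_comm
  rw [h1, h2, sq, Finset.sum_mul_sum]
  simp only [Finset.sum_sub_distrib]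

end Covariance

/-- Fix `δ ∈ (0,1)` and `c > 1`. There is a constant `d > 0`
(depending only on `δ` and `c`) such that in the random fs-relation graph model with
`n1 = δn`, `n2 = (1-δ)n` and `m - n ≥ m/c`, one has `Var[Z] ≤ d·|T|/m³`. -/
theorem Z_variance_bound (δ : ℝ) (hδ0 : 0 < δ) (hδ1 : δ < 1) (c : ℝ) (hc : 1 < c) :
    ∃ d : ℝ, 0 < d ∧ ∀ n n1 n2 m : ℕ,
      (n1 : ℝ) = δ * n → (n2 : ℝ) = (1 - δ) * n → n < m →
      (m : ℝ) / c ≤ (m : ℝ) - (n : ℝ) →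
      fsExp n1 n2 m (fun ω => Ztotal n1 n2 m ω ^ 2) -
          fsExp n1 n2 m (Ztotal n1 n2 m) ^ 2 ≤
        d * ((Ttup n1 n2).card : ℝ) / (m : ℝ) ^ 3 := by
  refine ⟨112 * c ^ 8, by positivity, fun n n1 n2 m hn1 hn2 hnm hmc => ?_⟩
  obtain rfl : n = n1 + n2 := by
    have : (n : ℝ) = (n1 + n2 : ℕ) := by push_cast; linarith
    exact_mod_cast this
  have hm : (0 : ℝ) < m := by exact_mod_cast (by omega : 0 < m)
  have hm1 : (1 : ℝ) ≤ m := by exact_mod_cast (by omega : 1 ≤ m)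
  have hc0 : 0 < c := by linarith
  have hle : ∀ k : ℕ, k ≤ m → (k : ℝ) * (c / m) ≤ c := fun k hk => by
    have : (k : ℝ) ≤ m := by exact_mod_cast hk
    calc (k : ℝ) * (c / m) ≤ m * (c / m) := by gcongr
      _ = c := by field_simp
  rw [variance_Ztotal_eq]
  calc _ ≤ ∑ v ∈ Ttup n1 n2, ∑ w ∈ Ttup n1 n2, 8 * c * covBound (c / m) v w :=
        Finset.sum_le_sum fun v hv => Finset.sum_le_sum fun w hw => cov_le hnm hc hmc hv hw
    _ ≤ ∑ v ∈ Ttup n1 n2, 8 * c * (14 * c ^ 4 * (c / m) ^ 3) := by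
        refine Finset.sum_le_sum fun v _ => ?_
        rw [← Finset.mul_sum]
        refine mul_le_mul_of_nonneg_left ?_ (by positivity)
        refine le_trans (Finset.sum_le_univ_sum_of_nonneg fun w =>
          covBound_nonneg (by positivity) v w) ?_
        exact sum_covBound_le (by positivity) hc.le (div_le_self hc0.le hm1)
          (hle n1 (by omega)) (hle n2 (by omega)) v
    _ = 112 * c ^ 8 * ((Ttup n1 n2).card : ℝ) / (m : ℝ) ^ 3 := by
        rw [Finset.sum_const, nsmul_eq_mul]
        field_simp
        ring
end
end

section
/- Fix constants δ ∈ (0,1) and c > 1. There exists a constant d' > 0, depending only on δ and c, such that in the random fs-relation graph model with n1 = δn and n2 = (1-δ)n (δn an integer) and with m - n ≥ m/c, for all sufficiently large n the random variable Z = Σ_{v ∈ T} Z_v satisfies Pr[Z = 0] ≤ d'·m³/n⁴. -/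
open scoped Classical
open Finset

noncomputable section

/-- Resampling one coordinate of a uniformly random function does not change averages. -/
theorem sum_sum_update_s17 {α β : Type*} [Fintype α] [DecidableEq α] [Fintype β]
    (x : α) (g : (α → β) → ℝ) :
    ∑ s : α → β, ∑ a : β, g (Function.update s x a) = Fintype.card β * ∑ s, g s := by
  have hinv : Function.Involutive
      (fun p : (α → β) × β => (Function.update p.1 x p.2, p.1 x)) := by
    rintro ⟨s, a⟩
    simp
  rw [← Fintype.sum_prod_type' (fun s a => g (Function.update s x a))]
  rw [Fintype.sum_equiv hinv.toPerm (fun p : (α → β) × β => g (Function.update p.1 x p.2))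
    (fun p => g p.1) (fun p => rfl)]
  rw [Fintype.sum_prod_type]
  simp [Finset.mul_sum]

theorem one_sub_pow_mul_le_one {q : ℝ} (h0 : 0 ≤ q) (h1 : q ≤ 1) (n : ℕ) :
    (1 - q) ^ n * (1 + n * q) ≤ 1 := by
  have hb : 1 + (n : ℝ) * q ≤ (1 + q) ^ n := one_add_mul_le_pow (by linarith) n
  calc (1 - q) ^ n * (1 + n * q) ≤ (1 - q) ^ n * (1 + q) ^ n :=
        mul_le_mul_of_nonneg_left hb (pow_nonneg (by linarith) n)
    _ = (1 - q ^ 2) ^ n := by rw [← mul_pow]; ring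
    _ ≤ 1 := pow_le_one₀ (by nlinarith) (by nlinarith)

theorem one_sub_mul_add_sq_le_pow {x : ℝ} (h0 : 0 ≤ x) (n : ℕ) (h : (n : ℝ) * x ≤ 1) :
    1 - n * x + n * (n - 1) * x ^ 2 / 3 ≤ (1 - x) ^ n := by
  induction n with
  | zero => simp
  | succ k ih =>
    push_cast at h ⊢
    have hk0 : (0 : ℝ) ≤ k := k.cast_nonneg
    have hkx : (k : ℝ) * x ≤ 1 := by nlinarith
    have hx1 : x ≤ 1 := by nlinarith
    have hstep := mul_le_mul_of_nonneg_right (ih hkx) (sub_nonneg.2 hx1)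
    rw [pow_succ]
    refine le_trans ?_ hstep
    have : 0 ≤ (k : ℝ) * x ^ 2 * (1 - (k * x - x)) :=
      mul_nonneg (by positivity) (by linarith)
    nlinarith

theorem card_filter_avoid {α β : Type*} [Fintype α] [DecidableEq α] [Fintype β] [DecidableEq β]
    (S : Finset β) [DecidablePred fun f : α → β => ∀ x, f x ∉ S] :
    #{f : α → β | ∀ x, f x ∉ S} = (Fintype.card β - #S) ^ Fintype.card α := by
  have : ({f : α → β | ∀ x, f x ∉ S} : Finset (α → β)) = Fintype.piFinset fun _ => Sᶜ := by
    ext f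
    simp
  rw [this, Fintype.card_piFinset]
  simp [Finset.card_compl]

/-- The variance of the number of empty bins, when `α` balls are thrown into `β` bins, is at most
the number of bins. -/
theorem sum_sq_empty_bins_le {α β : Type*} [Fintype α] [DecidableEq α] [Fintype β]
    [DecidableEq β] [Nonempty β] :
    ∑ f : α → β, ((Fintype.card β : ℝ) * (1 - 1 / Fintype.card β) ^ Fintype.card α -
        #(univ.image f)ᶜ) ^ 2 ≤
      Fintype.card β * (Fintype.card β : ℝ) ^ Fintype.card α := by
  set b := Fintype.card β with hb
  set a := Fintype.card α with ha
  have hb1 : 1 ≤ b := Fintype.card_pos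
  have hbR : (1 : ℝ) ≤ b := by exact_mod_cast hb1
  set r : ℝ := 1 - 1 / b with hr
  have hbr : (b : ℝ) * r = b - 1 := by rw [hr]; field_simp
  have hX : ∀ f : α → β, (#(univ.image f)ᶜ : ℝ) =
      ∑ i : β, if ∀ x, f x ∉ ({i} : Finset β) then (1 : ℝ) else 0 := by
    intro f
    rw [Finset.sum_boole]
    congr 2
    ext i
    simp
  have hone : ∀ i : β, ∑ f : α → β, (if ∀ x, f x ∉ ({i} : Finset β) then (1 : ℝ) else 0) =
      (b : ℝ) ^ a * r ^ a := by
    intro i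
    rw [Finset.sum_boole, card_filter_avoid, ← mul_pow, hbr]
    simp [← hb, ← ha, Nat.cast_sub hb1]
  have hfirst : ∑ f : α → β, (#(univ.image f)ᶜ : ℝ) = b * ((b : ℝ) ^ a * r ^ a) := by
    simp_rw [hX]
    rw [Finset.sum_comm]
    simp_rw [hone]
    simp [← hb]
  have htwo : ∀ i j : β, ∑ f : α → β, ((if ∀ x, f x ∉ ({i} : Finset β) then (1 : ℝ) else 0) *
      (if ∀ x, f x ∉ ({j} : Finset β) then (1 : ℝ) else 0)) ≤
      (if i = j then (b : ℝ) ^ a else 0) + (b : ℝ) ^ a * (r ^ a) ^ 2 := by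
    intro i j
    by_cases hij : i = j
    · subst hij
      rw [if_pos rfl]
      have h1 : ∑ f : α → β, ((if ∀ x, f x ∉ ({i} : Finset β) then (1 : ℝ) else 0) *
          (if ∀ x, f x ∉ ({i} : Finset β) then (1 : ℝ) else 0)) ≤ ∑ f : α → β, (1 : ℝ) := by
        refine Finset.sum_le_sum fun f _ => ?_
        split_ifs <;> norm_num
      have h2 : ∑ f : α → β, (1 : ℝ) = (b : ℝ) ^ a := by simp [← hb, ← ha]
      have h3 : 0 ≤ (b : ℝ) ^ a * (r ^ a) ^ 2 := by positivity
      linarith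
    · rw [if_neg hij, zero_add]
      have h1 : ∀ f : α → β, ((if ∀ x, f x ∉ ({i} : Finset β) then (1 : ℝ) else 0) *
          (if ∀ x, f x ∉ ({j} : Finset β) then (1 : ℝ) else 0)) =
          if ∀ x, f x ∉ ({i, j} : Finset β) then (1 : ℝ) else 0 := by
        intro f
        simp only [Finset.mem_insert, Finset.mem_singleton, not_or, forall_and]
        by_cases h : ∀ x, f x ≠ i <;> simp [h]
      simp_rw [h1]
      have hb2 : 2 ≤ b := by
        rw [← Finset.card_pair hij]
        exact Finset.card_le_univ _
      rw [Finset.sum_boole, card_filter_avoid, Finset.card_pair hij, ← hb, ← ha, ← pow_mul,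
        mul_comm a 2, pow_mul, ← mul_pow]
      push_cast [Nat.cast_sub hb2]
      have hb2R : (2 : ℝ) ≤ b := by exact_mod_cast hb2
      refine pow_le_pow_left₀ (by linarith) ?_ a
      have : (b : ℝ) * r ^ 2 = b - 2 + 1 / b := by rw [hr]; field_simp; ring
      rw [this]
      have : 0 ≤ 1 / (b : ℝ) := by positivity
      linarith
  have hsecond : ∑ f : α → β, (#(univ.image f)ᶜ : ℝ) ^ 2 ≤
      b * (b : ℝ) ^ a + b ^ 2 * ((b : ℝ) ^ a * (r ^ a) ^ 2) := by
    simp_rw [hX, sq (∑ i : β, _), Finset.sum_mul_sum]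
    rw [Finset.sum_comm]
    calc _ ≤ ∑ i : β, ∑ j : β,
          ((if i = j then (b : ℝ) ^ a else 0) + (b : ℝ) ^ a * (r ^ a) ^ 2) := by
          refine Finset.sum_le_sum fun i _ => ?_
          rw [Finset.sum_comm]
          exact Finset.sum_le_sum fun j _ => htwo i j
      _ = _ := by
          simp [Finset.sum_add_distrib, ← hb]
          ring
  have hexp : ∀ f : α → β, ((b : ℝ) * r ^ a - #(univ.image f)ᶜ) ^ 2 =
      (b * r ^ a) ^ 2 - 2 * (b * r ^ a) * #(univ.image f)ᶜ + (#(univ.image f)ᶜ : ℝ) ^ 2 :=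
    fun f => by ring
  simp_rw [hexp]
  rw [Finset.sum_add_distrib, Finset.sum_sub_distrib, ← Finset.mul_sum, hfirst]
  have hconst : ∑ f : α → β, ((b : ℝ) * r ^ a) ^ 2 = (b : ℝ) ^ a * (b * r ^ a) ^ 2 := by
    simp [← hb, ← ha]
  rw [hconst]
  nlinarith [hsecond]

/-- Chebyshev's inequality for the number of empty bins. -/
theorem card_filter_empty_bins_le {α β : Type*} [Fintype α] [DecidableEq α] [Fintype β]
    [DecidableEq β] [Nonempty β] {t : ℝ} (ht : 0 < t) (p : (α → β) → Prop) [DecidablePred p]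
    (hp : ∀ f, p f → t ≤ |(Fintype.card β : ℝ) * (1 - 1 / Fintype.card β) ^ Fintype.card α -
        #(univ.image f)ᶜ|) :
    (#{f : α → β | p f} : ℝ) ≤
      (Fintype.card β : ℝ) ^ Fintype.card α * (Fintype.card β / t ^ 2) := by
  have h : (#{f : α → β | p f} : ℝ) * t ^ 2 ≤
      Fintype.card β * (Fintype.card β : ℝ) ^ Fintype.card α := by
    refine le_trans ?_ (sum_sq_empty_bins_le (α := α) (β := β))
    rw [← nsmul_eq_mul, ← Finset.sum_const, Finset.sum_filter]
    refine Finset.sum_le_sum fun f _ => ?_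
    split_ifs with hf
    · rw [← sq_abs (_ - _)]
      exact pow_le_pow_left₀ ht.le (hp f hf) 2
    · positivity
  rw [← mul_div_assoc, le_div_iff₀ (by positivity)]
  linarith

theorem card_filter_surplus_lt_le {α β : Type*} [Fintype α] [DecidableEq α] [Fintype β]
    [DecidableEq β] (h2 : 2 ≤ Fintype.card α) (hle : Fintype.card α ≤ Fintype.card β) :
    (#{f : α → β | (Fintype.card α : ℝ) - #(univ.image f) <
        (Fintype.card α : ℝ) ^ 2 / (12 * Fintype.card β)} : ℝ) ≤
      (Fintype.card β : ℝ) ^ Fintype.card α *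
        (144 * (Fintype.card β : ℝ) ^ 3 / (Fintype.card α : ℝ) ^ 4) := by
  have hne : Nonempty β := Fintype.card_pos_iff.1 (by omega)
  have haR : (2 : ℝ) ≤ Fintype.card α := by exact_mod_cast h2
  have hbR : (Fintype.card α : ℝ) ≤ Fintype.card β := by exact_mod_cast hle
  have hcomp : ∀ f : α → β, (#(univ.image f)ᶜ : ℝ) = Fintype.card β - #(univ.image f) := by
    intro f
    rw [Finset.card_compl, Nat.cast_sub (Finset.card_le_univ _)]
  set a := Fintype.card α
  set b := Fintype.card β
  have hb0 : (0 : ℝ) < b := by linarith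
  have hmean : (a : ℝ) ^ 2 / (6 * b) ≤ a - b + b * (1 - 1 / b) ^ a := by
    have h := mul_le_mul_of_nonneg_left (one_sub_mul_add_sq_le_pow (x := 1 / (b : ℝ))
      (by positivity) a (by rw [mul_one_div, div_le_one hb0]; exact hbR)) hb0.le
    have h1 : (b : ℝ) * (1 - a * (1 / b) + a * (a - 1) * (1 / b) ^ 2 / 3) =
        b - a + a * (a - 1) / (3 * b) := by field_simp
    have h2 : (a : ℝ) ^ 2 / (6 * b) ≤ a * (a - 1) / (3 * b) := by
      rw [div_le_div_iff₀ (by positivity) (by positivity)]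
      nlinarith [mul_nonneg (mul_nonneg (by linarith : (0 : ℝ) ≤ a)
        (by linarith : (0 : ℝ) ≤ a - 2)) hb0.le]
    linarith
  have ht : (a : ℝ) ^ 2 / (6 * b) = 2 * (a ^ 2 / (12 * b)) := by field_simp; norm_num
  have ht0 : 0 < (a : ℝ) ^ 2 / (12 * b) := by positivity
  refine (card_filter_empty_bins_le ht0 _ fun f hf => ?_).trans_eq ?_
  · refine le_trans ?_ (le_abs_self _)
    rw [hcomp]
    linarith
  · change (b : ℝ) ^ a * (b / (a ^ 2 / (12 * b)) ^ 2) = _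
    field_simp
    norm_num

theorem card_filter_image_lt_le {α β : Type*} [Fintype α] [DecidableEq α] [Fintype β]
    [DecidableEq β] (h1 : 1 ≤ Fintype.card α) (hle : Fintype.card α ≤ Fintype.card β) :
    (#{f : α → β | (#(univ.image f) : ℝ) < (Fintype.card α : ℝ) / 4} : ℝ) ≤
      (Fintype.card β : ℝ) ^ Fintype.card α *
        (16 * (Fintype.card β : ℝ) / (Fintype.card α : ℝ) ^ 2) := by
  have hne : Nonempty β := Fintype.card_pos_iff.1 (by omega)
  have haR : (1 : ℝ) ≤ Fintype.card α := by exact_mod_cast h1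
  have hbR : (Fintype.card α : ℝ) ≤ Fintype.card β := by exact_mod_cast hle
  have hcomp : ∀ f : α → β, (#(univ.image f)ᶜ : ℝ) = Fintype.card β - #(univ.image f) := by
    intro f
    rw [Finset.card_compl, Nat.cast_sub (Finset.card_le_univ _)]
  set a := Fintype.card α
  set b := Fintype.card β
  have hb0 : (0 : ℝ) < b := by linarith
  have hmean : (b : ℝ) * (1 - 1 / b) ^ a ≤ b - a / 2 := by
    have h := one_sub_pow_mul_le_one (q := 1 / (b : ℝ)) (by positivity)
      (by rw [div_le_one hb0]; linarith) a
    have h2 : (b : ℝ) * (1 - 1 / b) ^ a * (b + a) ≤ b * b := by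
      have h3 := mul_le_mul_of_nonneg_left h (by positivity : 0 ≤ (b : ℝ) * b)
      have h4 : (b : ℝ) * b * ((1 - 1 / b) ^ a * (1 + a * (1 / b))) =
        b * (1 - 1 / b) ^ a * (b + a) := by field_simp
      linarith
    refine le_of_mul_le_mul_right (h2.trans ?_) (by linarith : (0 : ℝ) < b + a)
    nlinarith
  have ht0 : 0 < (a : ℝ) / 4 := by positivity
  refine (card_filter_empty_bins_le ht0 _ fun f hf => ?_).trans_eq ?_
  · refine le_trans ?_ (neg_le_abs _)
    rw [hcomp]
    linarith
  · change (b : ℝ) ^ a * (b / (a / 4) ^ 2) = _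
    field_simp
    norm_num

/-- Within `A`, any two points identified by `f` whose values under `s` lie in `F` have the same
value under `s`. -/
def NoSplitPair {α β γ : Type*} (f : α → γ) (F : Finset β) (A : Finset α) (s : α → β) : Prop :=
  ∀ x ∈ A, ∀ y ∈ A, x ≠ y → f x = f y → s x ∈ F → s y ∈ F → s x = s y

theorem sq_card_mul_card_filter_and_pair {α β : Type*} [Fintype α] [DecidableEq α] [Fintype β]
    {x y : α} (hxy : x ≠ y) (p : (α → β) → Prop) (R : β → β → Prop)
    (hp : ∀ s a, p (Function.update s x a) ↔ p s) (hp' : ∀ s a, p (Function.update s y a) ↔ p s) :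
    (Fintype.card β : ℝ) ^ 2 * #{s : α → β | p s ∧ R (s x) (s y)} =
      #{s : α → β | p s} * #{r : β × β | R r.1 r.2} := by
  have h1 := sum_sum_update_s17 (β := β) x
    (fun s => ∑ b : β, if p (Function.update s y b) ∧
      R (Function.update s y b x) (Function.update s y b y) then (1 : ℝ) else 0)
  rw [sum_sum_update_s17 y (fun s => if p s ∧ R (s x) (s y) then (1 : ℝ) else 0),
    Finset.sum_boole] at h1
  rw [sq, mul_assoc, ← h1]
  simp only [hp, hp', Function.update_self, Function.update_of_ne hxy]
  have h2 : ∀ s : α → β, ∑ a : β, ∑ b : β, (if p s ∧ R a b then (1 : ℝ) else 0) =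
      (if p s then 1 else 0) * #{r : β × β | R r.1 r.2} := by
    intro s
    rw [← Finset.sum_boole, Fintype.sum_prod_type]
    by_cases h : p s <;> simp [h]
  simp_rw [h2]
  rw [← Finset.sum_mul, Finset.sum_boole]

theorem exists_card_noSplitPair_le {α β γ : Type*} [Fintype α] [DecidableEq α] [Fintype β]
    [DecidableEq β] [DecidableEq γ] [Nonempty β] (f : α → γ) (F : Finset β) (A : Finset α) :
    ∃ L : ℕ, #A ≤ 2 * L + #(A.image f) ∧
      (#{s : α → β | NoSplitPair f F A s} : ℝ) ≤ (Fintype.card β : ℝ) ^ Fintype.card α *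
        (1 - #F * (#F - 1) / (Fintype.card β : ℝ) ^ 2) ^ L := by
  induction A using Finset.strongInduction with
  | H A ih =>
    by_cases hinj : Set.InjOn f A
    · refine ⟨0, by rw [Finset.card_image_of_injOn hinj]; omega, ?_⟩
      have h := Finset.card_le_univ ({s : α → β | NoSplitPair f F A s} : Finset (α → β))
      rw [Fintype.card_fun] at h
      simpa using (by exact_mod_cast h :
        (#{s : α → β | NoSplitPair f F A s} : ℝ) ≤ (Fintype.card β : ℝ) ^ Fintype.card α)
    · simp only [Set.InjOn, not_forall] at hinj
      obtain ⟨x, hx, y, hy, hf, hxy⟩ := hinj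
      have hx' : x ∈ A := hx
      have hy' : y ∈ A := hy
      set B := (A.erase x).erase y with hB
      have hyx : y ∈ A.erase x := Finset.mem_erase.2 ⟨Ne.symm hxy, hy'⟩
      have hBA : B ⊂ A := (Finset.erase_ssubset hyx).trans (Finset.erase_ssubset hx')
      obtain ⟨L, hL, hle⟩ := ih B hBA
      have hcard : #B + 2 = #A := by
        have h1 := Finset.card_erase_add_one hyx
        have h2 := Finset.card_erase_add_one hx'
        rw [← hB] at h1
        omega
      have himg : #(B.image f) ≤ #(A.image f) :=
        Finset.card_le_card (Finset.image_subset_image hBA.subset)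
      refine ⟨L + 1, by omega, ?_⟩
      have hxB : ∀ z ∈ B, z ≠ x := by
        rintro z hz rfl
        simp [hB] at hz
      have hyB : ∀ z ∈ B, z ≠ y := by
        rintro z hz rfl
        simp [hB] at hz
      have hupd : ∀ w : α, (∀ z ∈ B, z ≠ w) → ∀ (s : α → β) a,
          NoSplitPair f F B (Function.update s w a) ↔ NoSplitPair f F B s := by
        intro w hw s a
        refine forall₂_congr fun u hu => forall₂_congr fun v hv => ?_
        rw [Function.update_of_ne (hw u hu), Function.update_of_ne (hw v hv)]
      have hR : (#{r : β × β | ¬(r.1 ∈ F ∧ r.2 ∈ F ∧ r.1 ≠ r.2)} : ℝ) =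
          (Fintype.card β : ℝ) ^ 2 - #F * (#F - 1) := by
        have h1 := Finset.card_filter_add_card_filter_not (s := (univ : Finset (β × β)))
          (fun r : β × β => r.1 ∈ F ∧ r.2 ∈ F ∧ r.1 ≠ r.2)
        have h2 : ({r : β × β | r.1 ∈ F ∧ r.2 ∈ F ∧ r.1 ≠ r.2} : Finset (β × β)) = F.offDiag := by
          ext r
          simp [Finset.mem_offDiag]
        rw [h2, Finset.offDiag_card, Finset.card_univ, Fintype.card_prod] at h1
        have h3 : #F ≤ #F * #F := Nat.le_mul_self _
        have h4 : (((#F * #F - #F : ℕ) : ℝ)) = #F * #F - #F := by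
          push_cast [Nat.cast_sub h3]; ring
        have h5 := congrArg (Nat.cast : ℕ → ℝ) h1
        push_cast [h4] at h5
        linarith
      have hpair : (Fintype.card β : ℝ) ^ 2 *
          #{s : α → β | NoSplitPair f F B s ∧ ¬(s x ∈ F ∧ s y ∈ F ∧ s x ≠ s y)} =
          #{s : α → β | NoSplitPair f F B s} *
            ((Fintype.card β : ℝ) ^ 2 - #F * (#F - 1)) := by
        rw [← hR]
        convert sq_card_mul_card_filter_and_pair hxy (NoSplitPair f F B)
          (fun a b : β => ¬(a ∈ F ∧ b ∈ F ∧ a ≠ b)) (hupd x hxB) (hupd y hyB)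
      have hsub : (#{s : α → β | NoSplitPair f F A s} : ℝ) ≤
          #{s : α → β | NoSplitPair f F B s ∧ ¬(s x ∈ F ∧ s y ∈ F ∧ s x ≠ s y)} := by
        refine Nat.cast_le.2 (Finset.card_le_card fun s hs => ?_)
        simp only [Finset.mem_filter, Finset.mem_univ, true_and] at hs ⊢
        exact ⟨fun u hu v hv => hs u (hBA.subset hu) v (hBA.subset hv),
          fun h => h.2.2 (hs x hx' y hy' hxy hf h.1 h.2.1)⟩
      have hb : (0 : ℝ) < Fintype.card β := by exact_mod_cast Fintype.card_pos
      have hq : 0 ≤ 1 - #F * ((#F : ℝ) - 1) / (Fintype.card β : ℝ) ^ 2 := by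
        have h1 : (Fintype.card β : ℝ) ^ 2 - #F * (#F - 1) ≥ 0 := by rw [← hR]; positivity
        rw [sub_nonneg, div_le_one (by positivity)]
        linarith
      have heq : (#{s : α → β | NoSplitPair f F B s ∧ ¬(s x ∈ F ∧ s y ∈ F ∧ s x ≠ s y)} : ℝ) =
          #{s : α → β | NoSplitPair f F B s} *
            (1 - #F * (#F - 1) / (Fintype.card β : ℝ) ^ 2) := by
        have hb2 : (Fintype.card β : ℝ) ^ 2 ≠ 0 := by positivity
        refine mul_left_cancel₀ hb2 (hpair.trans ?_)
        field_simp
      calc _ ≤ _ := hsub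
        _ = _ := heq
        _ ≤ _ := mul_le_mul_of_nonneg_right hle hq
        _ = _ := by rw [pow_succ _ L, mul_assoc]

theorem card_noSplitPair_le {α β γ : Type*} [Fintype α] [DecidableEq α] [Fintype β]
    [DecidableEq β] [DecidableEq γ] [Nonempty β] (f : α → γ) (F : Finset β) {S Q : ℝ}
    (hS0 : 0 < S) (hS : S ≤ Fintype.card α - #(univ.image f)) (hQ0 : 0 < Q)
    (hQ : Q ≤ #F * (#F - 1)) :
    (#{s : α → β | NoSplitPair f F univ s} : ℝ) ≤ (Fintype.card β : ℝ) ^ Fintype.card α *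
      (2 * (Fintype.card β : ℝ) ^ 2 / (S * Q)) := by
  obtain ⟨L, hL, hle⟩ := exists_card_noSplitPair_le f F (univ : Finset α)
  refine hle.trans (mul_le_mul_of_nonneg_left ?_ (by positivity))
  have hb : (0 : ℝ) < Fintype.card β := by exact_mod_cast Fintype.card_pos
  have hFb : (#F : ℝ) ≤ Fintype.card β := by exact_mod_cast Finset.card_le_univ F
  have hLS : S / 2 ≤ L := by
    have : (Fintype.card α : ℝ) ≤ 2 * L + #(univ.image f) := by exact_mod_cast hL
    linarith
  have hq0 : Q / (Fintype.card β : ℝ) ^ 2 ≤ #F * ((#F : ℝ) - 1) / (Fintype.card β : ℝ) ^ 2 := by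
    gcongr
  have hq1 : #F * ((#F : ℝ) - 1) / (Fintype.card β : ℝ) ^ 2 ≤ 1 := by
    rw [div_le_one (by positivity)]
    nlinarith [(Nat.cast_nonneg #F : (0 : ℝ) ≤ #F)]
  set q := #F * ((#F : ℝ) - 1) / (Fintype.card β : ℝ) ^ 2
  have hqpos : 0 < Q / (Fintype.card β : ℝ) ^ 2 := by positivity
  have hpow := one_sub_pow_mul_le_one (hqpos.le.trans hq0) hq1 L
  have hLq : S / 2 * (Q / (Fintype.card β : ℝ) ^ 2) ≤ 1 + L * q := by
    have := mul_le_mul hLS hq0 hqpos.le (by positivity)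
    linarith
  have h0 : 0 ≤ (1 - q) ^ L := pow_nonneg (by linarith) L
  have h1 : (1 - q) ^ L * (S / 2 * (Q / (Fintype.card β : ℝ) ^ 2)) ≤ 1 :=
    (mul_le_mul_of_nonneg_left hLq h0).trans hpow
  rw [← le_div_iff₀ (by positivity)] at h1
  refine h1.trans_eq ?_
  field_simp

theorem sum_card_noSplitPair_le {α α' β γ : Type*} [Fintype α] [DecidableEq α] [Fintype α']
    [DecidableEq α'] [Fintype β] [DecidableEq β] [DecidableEq γ] (f : α → γ) {S : ℝ}
    (hS0 : 0 < S) (hS : S ≤ Fintype.card α - #(univ.image f)) (h8 : 8 ≤ Fintype.card α')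
    (hle : Fintype.card α' ≤ Fintype.card β) :
    ∑ g : α' → β, (#{s : α → β | NoSplitPair f (univ.image g) univ s} : ℝ) ≤
      (Fintype.card β : ℝ) ^ (Fintype.card α + Fintype.card α') *
        (16 * Fintype.card β / (Fintype.card α' : ℝ) ^ 2 +
          64 * (Fintype.card β : ℝ) ^ 2 / (S * (Fintype.card α' : ℝ) ^ 2)) := by
  have hne : Nonempty β := Fintype.card_pos_iff.1 (by omega)
  have h8R : (8 : ℝ) ≤ Fintype.card α' := by exact_mod_cast h8
  have hbound : ∀ g : α' → β, (#{s : α → β | NoSplitPair f (univ.image g) univ s} : ℝ) ≤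
      (Fintype.card β : ℝ) ^ Fintype.card α *
        (if (#(univ.image g) : ℝ) < (Fintype.card α' : ℝ) / 4 then 1 else 0) +
      (Fintype.card β : ℝ) ^ Fintype.card α *
        (64 * (Fintype.card β : ℝ) ^ 2 / (S * (Fintype.card α' : ℝ) ^ 2)) := by
    intro g
    split_ifs with hg
    · have h := Finset.card_le_univ
        ({s : α → β | NoSplitPair f (univ.image g) univ s} : Finset (α → β))
      rw [Fintype.card_fun] at h
      have h' : (#{s : α → β | NoSplitPair f (univ.image g) univ s} : ℝ) ≤
        (Fintype.card β : ℝ) ^ Fintype.card α := by exact_mod_cast h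
      rw [mul_one]
      exact h'.trans (le_add_of_nonneg_right (by positivity))
    · rw [not_lt] at hg
      have hQ : (Fintype.card α' : ℝ) ^ 2 / 32 ≤
          #(univ.image g) * ((#(univ.image g) : ℝ) - 1) := by
        nlinarith
      refine (card_noSplitPair_le f _ hS0 hS (by positivity) hQ).trans_eq ?_
      rw [mul_zero, zero_add]
      field_simp
      norm_num
  refine (Finset.sum_le_sum fun g _ => hbound g).trans ?_
  rw [Finset.sum_add_distrib, ← Finset.mul_sum, Finset.sum_boole, Finset.sum_const,
    Finset.card_univ, Fintype.card_fun, nsmul_eq_mul]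
  have h := mul_le_mul_of_nonneg_left
    (card_filter_image_lt_le (α := α') (β := β) (by omega) hle)
    (by positivity : 0 ≤ (Fintype.card β : ℝ) ^ Fintype.card α)
  push_cast
  rw [pow_add]
  linarith

theorem sum_avoid_eq_sum_subtype {α β : Type*} [Fintype α] [DecidableEq α] [Fintype β]
    [DecidableEq β] (S : Finset β)
    [DecidablePred fun s : α → β => ∀ x, s x ∉ S] (g : (α → β) → ℝ) :
    ∑ s : α → β, (if ∀ x, s x ∉ S then g s else 0) =
      ∑ s : α → {i // i ∉ S}, g fun x => s x := by
  symm
  refine Fintype.sum_of_injective (fun (s : α → {i // i ∉ S}) x => (s x : β)) ?_ _ _ ?_ ?_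
  · intro s t hst
    funext x
    exact Subtype.ext (congrFun hst x)
  · intro s hs
    rw [if_neg]
    exact fun h => hs ⟨fun x => ⟨s x, h x⟩, rfl⟩
  · intro s
    rw [if_pos fun x => (s x).2]

theorem sum_avoid_uniform_le_one {α β : Type*} [Fintype α] [DecidableEq α] [Fintype β]
    [DecidableEq β] (S : Finset β)
    [DecidablePred fun s : α → β => ∀ x, s x ∉ S] :
    ∑ s : α → β, (if ∀ x, s x ∉ S then
      (1 / ((Fintype.card β : ℝ) - #S)) ^ Fintype.card α else 0) ≤ 1 := by
  rw [← Finset.sum_filter, Finset.sum_const, card_filter_avoid, nsmul_eq_mul, Nat.cast_pow,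
    Nat.cast_sub (Finset.card_le_univ S), ← mul_pow, mul_one_div]
  have h : 0 ≤ (Fintype.card β : ℝ) - #S :=
    sub_nonneg.2 (Nat.cast_le.2 (Finset.card_le_univ S))
  exact pow_le_one₀ (div_nonneg h h) (div_self_le_one _)

theorem noSplitPair_of_Ztotal_eq_zero {n1 n2 m : ℕ} {ω : FSSpace n1 n2 m}
    (h : Ztotal n1 n2 m ω = 0) : NoSplitPair (fOne ω) (FTwo ω) univ (sOne ω) := by
  have hlt : ∀ x y, x < y → fOne ω x = fOne ω y → sOne ω x ∈ FTwo ω → sOne ω y ∈ FTwo ω →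
      sOne ω x = sOne ω y := by
    intro x y hxy hf hx hy
    obtain ⟨y1, -, h1⟩ := Finset.mem_image.1 hx
    obtain ⟨y2, -, h2⟩ := Finset.mem_image.1 hy
    by_contra hne
    have hmem : (x, y, y1, y2) ∈ Ttup n1 n2 := by
      simp only [Ttup, Finset.mem_filter, Finset.mem_univ, true_and]
      refine ⟨hxy, ?_⟩
      rintro rfl
      exact hne (h1.symm.trans h2)
    have hnonneg : ∀ v ∈ Ttup n1 n2, 0 ≤ Zind v ω := by
      intro v _
      unfold Zind
      split_ifs <;> norm_num
    have h0 := (Finset.sum_eq_zero_iff_of_nonneg hnonneg).1 h _ hmem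
    rw [Zind, if_pos ⟨hf, h1, h2⟩] at h0
    exact one_ne_zero h0
  intro x _ y _ hxy hf hx hy
  rcases lt_or_gt_of_ne hxy with hxy | hxy
  · exact hlt x y hxy hf hx hy
  · exact (hlt y x hxy hf.symm hy hx).symm

theorem noSplitPair_coe_iff {α β γ : Type*} [DecidableEq β] {α' : Type*} [Fintype α']
    (p : β → Prop) (f : α → γ) (g : α' → {i // p i}) (A : Finset α) (s : α → {i // p i}) :
    NoSplitPair f (univ.image fun y => (g y : β)) A (fun x => (s x : β)) ↔
      NoSplitPair f (univ.image g) A s := by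
  simp [NoSplitPair, Subtype.ext_iff]

/-- After summing out the `s2`-items, the probability of `Z = 0` is bounded by the normalized count
of choices of `s1` and `f2` without a split pair. -/
theorem fsProb_Ztotal_eq_zero_le (n1 n2 m : ℕ) :
    fsProb n1 n2 m (fun ω => Ztotal n1 n2 m ω = 0) ≤
      ∑ f : Fin n1 → Fin m, (1 / (m : ℝ)) ^ n1 *
        ((1 / ((m : ℝ) - #(univ.image f))) ^ (n1 + n2) *
          ∑ g : Fin n2 → {i // i ∉ univ.image f},
            (#{s : Fin n1 → {i // i ∉ univ.image f} |
              NoSplitPair f (univ.image g) univ s} : ℝ)) := by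
  unfold fsProb
  rw [Fintype.sum_prod_type]
  refine Finset.sum_le_sum fun f _ => ?_
  rw [Fintype.sum_prod_type]
  simp_rw [Fintype.sum_prod_type]
  set F := univ.image f with hF
  have hFm : (#F : ℝ) ≤ m := by
    exact_mod_cast (Finset.card_le_univ F).trans_eq (Fintype.card_fin m)
  set w : ℝ := (1 / (m : ℝ)) ^ n1 * (1 / ((m : ℝ) - #F)) ^ (n1 + n2) with hw
  have hw0 : 0 ≤ w := by
    have : 0 ≤ (m : ℝ) - #F := by linarith
    positivity
  have hterm : ∀ (s : Fin n1 → Fin m) (g : Fin n2 → Fin m),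
      (∑ t : Fin n2 → Fin m, if Ztotal n1 n2 m (f, s, g, t) = 0 then
        fsWeight n1 n2 m (f, s, g, t) else 0) ≤
      if ∀ x, s x ∉ F then if ∀ y, g y ∉ F then
        if NoSplitPair f (univ.image g) univ s then w else 0 else 0 else 0 := by
    intro s g
    by_cases hs : ∀ x, s x ∉ F
    · by_cases hg : ∀ y, g y ∉ F
      · rw [if_pos hs, if_pos hg]
        by_cases hN : NoSplitPair f (univ.image g) univ s
        · rw [if_pos hN]
          have hsum := sum_avoid_uniform_le_one (α := Fin n2) (F ∪ univ.image g)
          rw [Fintype.card_fin, Fintype.card_fin] at hsum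
          calc _ ≤ ∑ t : Fin n2 → Fin m, w * (if ∀ y, t y ∉ F ∪ univ.image g then
                (1 / ((m : ℝ) - #(F ∪ univ.image g))) ^ n2 else 0) := by
                refine Finset.sum_le_sum fun t _ => ?_
                have hcard : (#(F ∪ univ.image g) : ℝ) ≤ m := by
                  exact_mod_cast (Finset.card_le_univ _).trans_eq (Fintype.card_fin m)
                have hnn : 0 ≤ (1 / ((m : ℝ) - #(F ∪ univ.image g))) ^ n2 := by
                  have : 0 ≤ (m : ℝ) - #(F ∪ univ.image g) := by linarith
                  positivity
                have hweight : fsWeight n1 n2 m (f, s, g, t) ≤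
                    w * (if ∀ y, t y ∉ F ∪ univ.image g then
                      (1 / ((m : ℝ) - #(F ∪ univ.image g))) ^ n2 else 0) := by
                  unfold fsWeight
                  by_cases ht : ∀ y, t y ∉ F ∪ univ.image g
                  · rw [if_pos ht, if_pos ⟨hs, hg, ht⟩]
                    exact le_rfl
                  · rw [if_neg ht, if_neg fun h => ht h.2.2, mul_zero]
                split_ifs at hweight ⊢ with h1 h2
                · exact hweight
                · exact hweight
                · exact mul_nonneg hw0 hnn
                · simp
            _ ≤ w := by
                rw [← Finset.mul_sum]
                exact mul_le_of_le_one_right hw0 hsum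
        · rw [if_neg hN]
          refine (Finset.sum_eq_zero fun t _ => if_neg fun h => hN ?_).le
          exact noSplitPair_of_Ztotal_eq_zero h
      · rw [if_pos hs, if_neg hg]
        refine (Finset.sum_eq_zero fun t _ => ?_).le
        have hzero : fsWeight n1 n2 m (f, s, g, t) = 0 := if_neg fun h => hg h.2.1
        rw [hzero, ite_self]
    · rw [if_neg hs]
      refine (Finset.sum_eq_zero fun t _ => ?_).le
      have hzero : fsWeight n1 n2 m (f, s, g, t) = 0 := if_neg fun h => hs h.1
      rw [hzero, ite_self]
  refine (Finset.sum_le_sum fun s _ => Finset.sum_le_sum fun g _ => hterm s g).trans_eq ?_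
  have hcomm : ∀ s : Fin n1 → Fin m, (∑ g : Fin n2 → Fin m, if ∀ x, s x ∉ F then
      if ∀ y, g y ∉ F then if NoSplitPair f (univ.image g) univ s then w else 0 else 0 else 0) =
      if ∀ x, s x ∉ F then ∑ g : Fin n2 → {i // i ∉ F},
        if NoSplitPair f (univ.image fun y => (g y : Fin m)) univ s then w else 0 else 0 := by
    intro s
    split_ifs
    · exact sum_avoid_eq_sum_subtype F
        (fun g => if NoSplitPair f (univ.image g) univ s then w else 0)
    · simp
  simp_rw [hcomm]
  rw [sum_avoid_eq_sum_subtype F (fun s => ∑ g : Fin n2 → {i // i ∉ F},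
        if NoSplitPair f (univ.image fun y => (g y : Fin m)) univ s then w else 0),
    Finset.sum_comm, ← mul_assoc, ← hw, Finset.mul_sum]
  refine Finset.sum_congr rfl fun g _ => ?_
  simp_rw [noSplitPair_coe_iff]
  rw [← Finset.sum_filter, Finset.sum_const, nsmul_eq_mul, mul_comm]

theorem fsProb_Ztotal_eq_zero_le_of_le {n1 n2 m : ℕ} (h1 : 2 ≤ n1) (h2 : 8 ≤ n2)
    (hm : n1 + n2 < m) :
    fsProb n1 n2 m (fun ω => Ztotal n1 n2 m ω = 0) ≤
      144 * (m : ℝ) ^ 3 / (n1 : ℝ) ^ 4 + (16 * m / (n2 : ℝ) ^ 2 +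
        768 * (m : ℝ) ^ 3 / ((n1 : ℝ) ^ 2 * (n2 : ℝ) ^ 2)) := by
  refine (fsProb_Ztotal_eq_zero_le n1 n2 m).trans ?_
  have hn1 : (2 : ℝ) ≤ n1 := by exact_mod_cast h1
  have hn2 : (8 : ℝ) ≤ n2 := by exact_mod_cast h2
  have hmR : (n1 : ℝ) + n2 < m := by exact_mod_cast hm
  have hm0 : (0 : ℝ) < m := by linarith
  set p : ℝ := 16 * m / (n2 : ℝ) ^ 2 + 768 * (m : ℝ) ^ 3 / ((n1 : ℝ) ^ 2 * (n2 : ℝ) ^ 2) with hp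
  have hp0 : 0 ≤ p := by positivity
  have hbound : ∀ f : Fin n1 → Fin m, (1 / (m : ℝ)) ^ n1 *
        ((1 / ((m : ℝ) - #(univ.image f))) ^ (n1 + n2) *
          ∑ g : Fin n2 → {i // i ∉ univ.image f},
            (#{s : Fin n1 → {i // i ∉ univ.image f} |
              NoSplitPair f (univ.image g) univ s} : ℝ)) ≤
      (1 / (m : ℝ)) ^ n1 *
        ((if (n1 : ℝ) - #(univ.image f) < (n1 : ℝ) ^ 2 / (12 * m) then 1 else 0) + p) := by
    intro f
    refine mul_le_mul_of_nonneg_left ?_ (by positivity)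
    have hF1 : #(univ.image f) ≤ n1 := Finset.card_image_le.trans_eq (by simp)
    have hFm : #(univ.image f) ≤ m := by omega
    have hFR : (#(univ.image f) : ℝ) ≤ n1 := by exact_mod_cast hF1
    have hM : Fintype.card {i // i ∉ univ.image f} = m - #(univ.image f) := by
      rw [Fintype.card_subtype_compl, Fintype.card_fin, Fintype.card_coe]
    have hMR : (Fintype.card {i // i ∉ univ.image f} : ℝ) = m - #(univ.image f) := by
      rw [hM, Nat.cast_sub hFm]
    have hMpos : (0 : ℝ) < m - #(univ.image f) := by linarith
    rw [one_div, inv_pow, inv_mul_le_iff₀ (by positivity)]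
    split_ifs with hf
    · refine (Finset.sum_le_sum fun g _ => Nat.cast_le.2 (Finset.card_le_univ _)).trans ?_
      rw [Finset.sum_const, Finset.card_univ, Fintype.card_fun, Fintype.card_fun, nsmul_eq_mul]
      push_cast
      rw [Fintype.card_fin, Fintype.card_fin, hMR, ← pow_add, add_comm n2]
      exact le_mul_of_one_le_right (by positivity) (by linarith)
    · rw [not_lt] at hf
      have h := sum_card_noSplitPair_le (α' := Fin n2) (β := {i // i ∉ univ.image f}) f
        (S := (n1 : ℝ) ^ 2 / (12 * m)) (by positivity) (by simpa using hf) (by simpa using h2)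
        (by rw [hM, Fintype.card_fin]; omega)
      rw [hMR, Fintype.card_fin, Fintype.card_fin] at h
      refine h.trans (mul_le_mul_of_nonneg_left ?_ (by positivity))
      have hMm : (m : ℝ) - #(univ.image f) ≤ m := by
        linarith [(Nat.cast_nonneg _ : (0 : ℝ) ≤ #(univ.image f))]
      rw [zero_add, hp]
      have e : 768 * (m : ℝ) ^ 3 / ((n1 : ℝ) ^ 2 * (n2 : ℝ) ^ 2) =
          64 * (m : ℝ) ^ 2 / ((n1 : ℝ) ^ 2 / (12 * m) * (n2 : ℝ) ^ 2) := by
        field_simp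
        norm_num
      rw [e]
      gcongr
  refine (Finset.sum_le_sum fun f _ => hbound f).trans ?_
  rw [← Finset.mul_sum, Finset.sum_add_distrib, Finset.sum_boole, Finset.sum_const,
    Finset.card_univ, Fintype.card_fun, nsmul_eq_mul, one_div, inv_pow,
    inv_mul_le_iff₀ (by positivity)]
  have h := card_filter_surplus_lt_le (α := Fin n1) (β := Fin m) (by simpa using h1)
    (by simp only [Fintype.card_fin]; omega)
  simp only [Fintype.card_fin] at h ⊢
  push_cast
  linarith

/-- Fix `δ ∈ (0,1)` and `c > 1`. There is a constant `d' > 0`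
(depending only on `δ` and `c`) such that in the random fs-relation graph model with
`n1 = δn`, `n2 = (1-δ)n` and `m - n ≥ m/c`, for all sufficiently large `n` one has
`Pr[Z = 0] ≤ d'·m³/n⁴`. -/
theorem prob_Z_eq_zero_bound (δ : ℝ) (hδ0 : 0 < δ) (hδ1 : δ < 1)
    (c : ℝ) (hc : 1 < c) :
    ∃ d' : ℝ, 0 < d' ∧ ∃ N : ℕ, ∀ n : ℕ, N ≤ n → ∀ n1 n2 m : ℕ,
      (n1 : ℝ) = δ * n → (n2 : ℝ) = (1 - δ) * n → n < m →
      (m : ℝ) / c ≤ (m : ℝ) - (n : ℝ) →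
      fsProb n1 n2 m (fun ω => Ztotal n1 n2 m ω = 0) ≤
        d' * (m : ℝ) ^ 3 / (n : ℝ) ^ 4 := by
  have hδ2 : 0 < 1 - δ := by linarith
  obtain ⟨N1, hN1⟩ := exists_nat_ge (2 / δ)
  obtain ⟨N2, hN2⟩ := exists_nat_ge (8 / (1 - δ))
  refine ⟨144 / δ ^ 4 + (16 / (1 - δ) ^ 2 + 768 / (δ ^ 2 * (1 - δ) ^ 2)), by positivity,
    max N1 N2, ?_⟩
  intro n hn n1 n2 m h1 h2 hm _
  have hnN1 : (N1 : ℝ) ≤ n := by exact_mod_cast (le_max_left N1 N2).trans hn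
  have hnN2 : (N2 : ℝ) ≤ n := by exact_mod_cast (le_max_right N1 N2).trans hn
  have hn1 : (2 : ℝ) ≤ n1 := by
    rw [h1, mul_comm]
    exact (div_le_iff₀ hδ0).1 (hN1.trans hnN1)
  have hn2 : (8 : ℝ) ≤ n2 := by
    rw [h2, mul_comm]
    exact (div_le_iff₀ hδ2).1 (hN2.trans hnN2)
  have hsum : n1 + n2 = n := by
    have : (n1 : ℝ) + n2 = n := by rw [h1, h2]; ring
    exact_mod_cast this
  refine (fsProb_Ztotal_eq_zero_le_of_le (by exact_mod_cast hn1) (by exact_mod_cast hn2)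
    (by omega)).trans ?_
  have hn0 : (0 : ℝ) < n := by
    rw [← hsum]
    push_cast
    linarith
  have hnm : (n : ℝ) ≤ m := by exact_mod_cast hm.le
  have hmid : 16 * (m : ℝ) / ((1 - δ) * n) ^ 2 ≤ 16 / (1 - δ) ^ 2 * (m ^ 3 / n ^ 4) := by
    have e : 16 * (m : ℝ) / ((1 - δ) * n) ^ 2 = 16 / (1 - δ) ^ 2 * (m * n ^ 2 / n ^ 4) := by
      field_simp
    rw [e]
    have : (m : ℝ) * n ^ 2 ≤ m ^ 3 := by
      rw [pow_succ' (m : ℝ) 2]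
      gcongr
    gcongr
  have h144 : 144 * (m : ℝ) ^ 3 / (δ * n) ^ 4 = 144 / δ ^ 4 * (m ^ 3 / n ^ 4) := by
    field_simp
  have h768 : 768 * (m : ℝ) ^ 3 / ((δ * n) ^ 2 * ((1 - δ) * n) ^ 2) =
      768 / (δ ^ 2 * (1 - δ) ^ 2) * (m ^ 3 / n ^ 4) := by
    field_simp
  rw [h1, h2, h144, h768, mul_div_assoc _ ((m : ℝ) ^ 3), add_mul, add_mul]
  linarith
end
end

section
/- In the random fs-relation graph model, if m - n ≥ m/c for a constant c > 1 and c²n/m < 1, then the probability that the random fs-relation graph contains a cycle (a closed walk using ℓ ≥ 2 distinct edges and ℓ distinct vertices) is at most (c²n/m)² / (1 - c²n/m). -/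
open scoped Classical
open Finset

noncomputable section

/-! ### Probability of prescribing the items of given applicants -/

/-- The weight of a function all of whose values are drawn uniformly from `T`, restricted to the
functions that agree with `p` on `A`. -/
def uniformOn {k m : ℕ} (T : Finset (Fin m)) (A : Finset (Fin k)) (p g : Fin k → Fin m) : ℝ :=
  if (∀ x, g x ∈ T) ∧ ∀ x ∈ A, g x = p x then (1 / (T.card : ℝ)) ^ k else 0

lemma uniformOn_nonneg {k m : ℕ} (T : Finset (Fin m)) (A : Finset (Fin k)) (p g : Fin k → Fin m) :
    0 ≤ uniformOn T A p g := by
  unfold uniformOn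
  split_ifs <;> positivity

lemma sum_uniformOn_le {k m : ℕ} (T : Finset (Fin m)) (hT : 0 < T.card) (A : Finset (Fin k))
    (p : Fin k → Fin m) : ∑ g, uniformOn T A p g ≤ (1 / (T.card : ℝ)) ^ A.card := by
  have hsub : (univ.filter fun g : Fin k → Fin m => (∀ x, g x ∈ T) ∧ ∀ x ∈ A, g x = p x) ⊆
      Fintype.piFinset fun x => if x ∈ A then {p x} else T := by
    intro g hg
    simp only [mem_filter, mem_univ, true_and] at hg
    rw [Fintype.mem_piFinset]
    intro x
    split_ifs with hx
    · simpa using hg.2 x hx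
    · exact hg.1 x
  have hcard := card_le_card hsub
  have hprod : (Fintype.piFinset fun x => if x ∈ A then {p x} else T).card =
      T.card ^ (k - A.card) := by
    rw [Fintype.card_piFinset]
    simp only [apply_ite Finset.card, card_singleton]
    rw [prod_ite]
    simp only [prod_const_one, prod_const, one_mul]
    congr 1
    rw [filter_not, card_sdiff]
    simp
  rw [hprod] at hcard
  have hA : A.card ≤ k := by simpa using card_le_univ A
  have hT' : (0 : ℝ) < T.card := by exact_mod_cast hT
  unfold uniformOn
  rw [← sum_filter, sum_const, nsmul_eq_mul]
  calc _ ≤ ((T.card : ℝ) ^ (k - A.card)) * (1 / (T.card : ℝ)) ^ k := by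
        gcongr
        exact_mod_cast hcard
    _ = _ := by
        rw [one_div, inv_pow, inv_pow, ← pow_sub_mul_pow (T.card : ℝ) hA]
        field_simp

lemma sum_uniformOn_le_pow {k m : ℕ} {K : ℝ} (T : Finset (Fin m)) (hT : 0 < T.card)
    (hK : 1 / (T.card : ℝ) ≤ K) (A : Finset (Fin k)) (p : Fin k → Fin m) :
    ∑ g, uniformOn T A p g ≤ K ^ A.card :=
  (sum_uniformOn_le T hT A p).trans (pow_le_pow_left₀ (by positivity) hK _)

lemma sum_prod_mul_le {α β : Type*} [Fintype α] [Fintype β] {f : α → ℝ} {g : α → β → ℝ}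
    {C D : ℝ} (hf : ∀ a, 0 ≤ f a) (hC : ∑ a, f a ≤ C) (hD : 0 ≤ D)
    (hg : ∀ a, ∑ b, g a b ≤ D) : ∑ w : α × β, f w.1 * g w.1 w.2 ≤ C * D := by
  rw [Fintype.sum_prod_type]
  simp only [← mul_sum]
  calc _ ≤ ∑ a, f a * D := sum_le_sum fun a _ => mul_le_mul_of_nonneg_left (hg a) (hf a)
    _ = (∑ a, f a) * D := by rw [sum_mul]
    _ ≤ C * D := by gcongr

/-- The first-choice item of an applicant. -/
def firstItem {n1 n2 m : ℕ} (ω : FSSpace n1 n2 m) : Fin n1 ⊕ Fin n2 → Fin m :=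
  Sum.elim (fOne ω) (fTwo ω)

/-- The second-choice item of an applicant. -/
def secondItem {n1 n2 m : ℕ} (ω : FSSpace n1 n2 m) : Fin n1 ⊕ Fin n2 → Fin m :=
  Sum.elim (sOne ω) (sTwo ω)

lemma fsWeight_nonneg {n1 n2 m : ℕ} (ω : FSSpace n1 n2 m) : 0 ≤ fsWeight n1 n2 m ω := by
  have h (s : Finset (Fin m)) : 0 ≤ (m : ℝ) - s.card := by
    rw [sub_nonneg]
    exact_mod_cast (card_le_univ s).trans_eq (Fintype.card_fin m)
  unfold fsWeight
  have h1 := h (FOne ω)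
  have h2 := h (FOne ω ∪ FTwo ω)
  split_ifs <;> positivity

lemma cast_card_compl {m : ℕ} (s : Finset (Fin m)) : ((sᶜ).card : ℝ) = (m : ℝ) - s.card := by
  rw [card_compl, Fintype.card_fin, Nat.cast_sub]
  exact (card_le_univ s).trans_eq (Fintype.card_fin m)

/-- The applicants in `X` receive the first-choice items `P` and the second-choice items `Q`. -/
def Prescribes {n1 n2 m : ℕ} (X : Finset (Fin n1 ⊕ Fin n2)) (P Q : Fin n1 ⊕ Fin n2 → Fin m)
    (ω : FSSpace n1 n2 m) : Prop :=
  ∀ a ∈ X, firstItem ω a = P a ∧ secondItem ω a = Q a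

lemma fsWeight_le_of_prescribes {n1 n2 m : ℕ} (X : Finset (Fin n1 ⊕ Fin n2))
    (P Q : Fin n1 ⊕ Fin n2 → Fin m) (ω : FSSpace n1 n2 m) :
    (if Prescribes X P Q ω then fsWeight n1 n2 m ω else 0) ≤
      uniformOn (∅ᶜ) X.toLeft (P ∘ Sum.inl) ω.1 *
        (uniformOn ((univ.image ω.1)ᶜ) X.toLeft (Q ∘ Sum.inl) ω.2.1 *
          (uniformOn ((univ.image ω.1)ᶜ) X.toRight (P ∘ Sum.inr) ω.2.2.1 *
            uniformOn ((univ.image ω.1 ∪ univ.image ω.2.2.1)ᶜ) X.toRight (Q ∘ Sum.inr)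
              ω.2.2.2)) := by
  by_cases hE : Prescribes X P Q ω ∧ FSValid ω
  · obtain ⟨hE, hV⟩ := hE
    rw [if_pos hE, fsWeight, if_pos hV]
    obtain ⟨h1, h2, h3⟩ := hV
    have hA : ∀ x ∈ X.toLeft, ω.1 x = P (Sum.inl x) ∧ ω.2.1 x = Q (Sum.inl x) := fun x hx =>
      hE (Sum.inl x) (mem_toLeft.1 hx)
    have hB : ∀ y ∈ X.toRight, ω.2.2.1 y = P (Sum.inr y) ∧ ω.2.2.2 y = Q (Sum.inr y) := fun y hy =>
      hE (Sum.inr y) (mem_toRight.1 hy)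
    rw [uniformOn, if_pos ⟨by simp, fun x hx => (hA x hx).1⟩,
      uniformOn, if_pos ⟨fun x => mem_compl.2 (h1 x), fun x hx => (hA x hx).2⟩,
      uniformOn, if_pos ⟨fun y => mem_compl.2 (h2 y), fun y hy => (hB y hy).1⟩,
      uniformOn, if_pos ⟨fun y => mem_compl.2 (h3 y), fun y hy => (hB y hy).2⟩]
    simp only [cast_card_compl, card_empty, Nat.cast_zero, sub_zero]
    apply le_of_eq
    rw [pow_add]
    simp only [FOne, FTwo, fOne, fTwo]
    ring
  · have hzero : (if Prescribes X P Q ω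
        then fsWeight n1 n2 m ω else 0) = 0 := by
      split_ifs with h
      · rw [fsWeight, if_neg fun hV => hE ⟨h, hV⟩]
      · rfl
    rw [hzero]
    have := @uniformOn_nonneg
    exact mul_nonneg (this ..) (mul_nonneg (this ..) (mul_nonneg (this ..) (this ..)))

lemma fsProb_prescribed_le {n1 n2 m : ℕ} {K : ℝ} (hm : n1 + n2 < m)
    (hK : 1 / ((m : ℝ) - ((n1 + n2 : ℕ) : ℝ)) ≤ K) (X : Finset (Fin n1 ⊕ Fin n2))
    (P Q : Fin n1 ⊕ Fin n2 → Fin m) :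
    fsProb n1 n2 m (Prescribes X P Q) ≤
      (K ^ 2) ^ X.card := by
  have hcompl : ∀ s : Finset (Fin m), s.card ≤ n1 + n2 →
      0 < (sᶜ).card ∧ 1 / ((sᶜ).card : ℝ) ≤ K := by
    intro s hs
    have hs' : (s.card : ℝ) ≤ ((n1 + n2 : ℕ) : ℝ) := by exact_mod_cast hs
    have hm' : ((n1 + n2 : ℕ) : ℝ) < m := by exact_mod_cast hm
    constructor
    · rw [card_compl, Fintype.card_fin]
      omega
    · rw [cast_card_compl]
      refine le_trans ?_ hK
      apply one_div_le_one_div_of_le <;> linarith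
  have hK0 : 0 ≤ K := (by positivity : (0 : ℝ) ≤ _).trans (hcompl ∅ (by simp)).2
  have himage : ∀ {k : ℕ} (g : Fin k → Fin m), (univ.image g).card ≤ k := fun g =>
    card_image_le.trans_eq (by simp)
  have hinner : ∀ f1 : Fin n1 → Fin m, ∑ w : (Fin n2 → Fin m) × (Fin n2 → Fin m),
      uniformOn ((univ.image f1)ᶜ) X.toRight (P ∘ Sum.inr) w.1 *
        uniformOn ((univ.image f1 ∪ univ.image w.1)ᶜ) X.toRight (Q ∘ Sum.inr) w.2 ≤
      K ^ X.toRight.card * K ^ X.toRight.card := by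
    intro f1
    obtain ⟨h, h'⟩ := hcompl (univ.image f1) ((himage f1).trans (by omega))
    refine sum_prod_mul_le
      (f := fun f2 => uniformOn ((univ.image f1)ᶜ) X.toRight (P ∘ Sum.inr) f2)
      (g := fun f2 s2 =>
        uniformOn ((univ.image f1 ∪ univ.image f2)ᶜ) X.toRight (Q ∘ Sum.inr) s2)
      (fun _ => uniformOn_nonneg ..) (sum_uniformOn_le_pow _ h h' _ _) (by positivity)
      fun f2 => ?_
    obtain ⟨h2, h2'⟩ := hcompl (univ.image f1 ∪ univ.image f2)
      ((card_union_le _ _).trans (add_le_add (himage f1) (himage f2)))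
    exact sum_uniformOn_le_pow _ h2 h2' _ _
  have hmiddle : ∀ f1 : Fin n1 → Fin m,
      ∑ w : (Fin n1 → Fin m) × (Fin n2 → Fin m) × (Fin n2 → Fin m),
      uniformOn ((univ.image f1)ᶜ) X.toLeft (Q ∘ Sum.inl) w.1 *
        (uniformOn ((univ.image f1)ᶜ) X.toRight (P ∘ Sum.inr) w.2.1 *
          uniformOn ((univ.image f1 ∪ univ.image w.2.1)ᶜ) X.toRight (Q ∘ Sum.inr) w.2.2) ≤
      K ^ X.toLeft.card * (K ^ X.toRight.card * K ^ X.toRight.card) := by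
    intro f1
    obtain ⟨h, h'⟩ := hcompl (univ.image f1) ((himage f1).trans (by omega))
    exact sum_prod_mul_le
      (f := fun s1 => uniformOn ((univ.image f1)ᶜ) X.toLeft (Q ∘ Sum.inl) s1)
      (g := fun _ (w : (Fin n2 → Fin m) × (Fin n2 → Fin m)) =>
        uniformOn ((univ.image f1)ᶜ) X.toRight (P ∘ Sum.inr) w.1 *
          uniformOn ((univ.image f1 ∪ univ.image w.1)ᶜ) X.toRight (Q ∘ Sum.inr) w.2)
      (fun _ => uniformOn_nonneg ..) (sum_uniformOn_le_pow _ h h' _ _) (by positivity)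
      fun _ => hinner f1
  obtain ⟨h, h'⟩ := hcompl ∅ (by simp)
  have houter := sum_prod_mul_le (f := fun f1 => uniformOn (∅ᶜ) X.toLeft (P ∘ Sum.inl) f1)
    (fun _ => uniformOn_nonneg ..) (sum_uniformOn_le_pow _ h h' _ _) (by positivity) hmiddle
  refine (sum_le_sum fun ω _ => fsWeight_le_of_prescribes X P Q ω).trans (houter.trans_eq ?_)
  rw [← card_toLeft_add_card_toRight (u := X)]
  ring

lemma fsProb_le_sum {n1 n2 m : ℕ} {ι : Type*} (I : Finset ι) {S : FSSpace n1 n2 m → Prop}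
    (E : ι → FSSpace n1 n2 m → Prop) (h : ∀ ω, FSValid ω → S ω → ∃ i ∈ I, E i ω) :
    fsProb n1 n2 m S ≤ ∑ i ∈ I, fsProb n1 n2 m (E i) := by
  unfold fsProb
  rw [sum_comm]
  refine sum_le_sum fun ω _ => ?_
  have hnonneg : ∀ i ∈ I, 0 ≤ if E i ω then fsWeight n1 n2 m ω else 0 := fun i _ => by
    split_ifs
    exacts [fsWeight_nonneg ω, le_rfl]
  by_cases hS : S ω ∧ FSValid ω
  · obtain ⟨i, hi, hE⟩ := h ω hS.2 hS.1
    rw [if_pos hS.1]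
    calc _ = if E i ω then fsWeight n1 n2 m ω else 0 := by rw [if_pos hE]
      _ ≤ _ := single_le_sum hnonneg hi
  · refine le_trans (le_of_eq ?_) (sum_nonneg hnonneg)
    split_ifs with h'
    · rw [fsWeight, if_neg fun hV => hS ⟨h', hV⟩]
    · rfl

/-! ### Counting oriented edge sequences

An edge of a closed walk is traversed either from its first-choice item to its second-choice item
(orientation `true`) or backwards (orientation `false`). In a valid outcome only some pairs of
oriented edges can be consecutive. -/

/-- One oriented edge can be followed by another one in a closed walk. -/
def MayFollow {n1 n2 : ℕ} : (Fin n1 ⊕ Fin n2) × Bool → (Fin n1 ⊕ Fin n2) × Bool → Prop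
  | (Sum.inl _, o), (Sum.inl _, o') => o' = !o
  | (Sum.inl _, o), (Sum.inr _, _) => o = true
  | (Sum.inr _, _), (Sum.inl _, o') => o' = false
  | (Sum.inr _, o), (Sum.inr _, o') => o' = !o

/-- The oriented edges at which the count of a closed walk is started. -/
def GoodStart {n1 n2 : ℕ} : (Fin n1 ⊕ Fin n2) × Bool → Prop
  | (Sum.inl _, o) => o = false
  | (Sum.inr _, o) => o = true

/-- A positive supersolution of the transfer matrix of `MayFollow`. -/
def potential (n1 n2 : ℕ) : (Fin n1 ⊕ Fin n2) × Bool → ℕ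
  | (Sum.inl _, true) => n1 + 2 * n2
  | _ => n1 + n2

/-- The sequences of `k + 1` oriented edges that start at `e` and respect `MayFollow`. -/
def edgeWalks {n1 n2 : ℕ} (k : ℕ) (e : (Fin n1 ⊕ Fin n2) × Bool) :
    Finset (Fin (k + 1) → (Fin n1 ⊕ Fin n2) × Bool) :=
  univ.filter fun t => t 0 = e ∧ ∀ i : Fin k, MayFollow (t i.castSucc) (t i.succ)

lemma sum_potential_le {n1 n2 : ℕ} (e : (Fin n1 ⊕ Fin n2) × Bool) :
    ∑ e' with MayFollow e e', potential n1 n2 e' ≤ (n1 + n2) * potential n1 n2 e := by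
  rw [sum_filter, Fintype.sum_prod_type, Fintype.sum_sum_type]
  rcases e with ⟨x | y, _ | _⟩ <;> simp [MayFollow, potential] <;> nlinarith

lemma edgeWalks_succ_subset {n1 n2 : ℕ} (k : ℕ) (e : (Fin n1 ⊕ Fin n2) × Bool) :
    edgeWalks (k + 1) e ⊆
      (univ.filter (MayFollow e)).biUnion fun e' =>
        (edgeWalks k e').image (Fin.cons (α := fun _ => (Fin n1 ⊕ Fin n2) × Bool) e) := by
  intro t ht
  simp only [edgeWalks, mem_filter, mem_univ, true_and] at ht
  obtain ⟨h0, hR⟩ := ht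
  simp only [mem_biUnion, mem_filter, mem_univ, true_and, mem_image, edgeWalks]
  refine ⟨t 1, ?_, Fin.tail t, ⟨rfl, fun i => hR i.succ⟩, ?_⟩
  · simpa [h0] using hR 0
  · rw [← h0, Fin.cons_self_tail]

lemma card_edgeWalks_le {n1 n2 : ℕ} (k : ℕ) (e : (Fin n1 ⊕ Fin n2) × Bool) :
    (n1 + n2) * (edgeWalks k e).card ≤ potential n1 n2 e * (n1 + n2) ^ k := by
  induction k generalizing e with
  | zero =>
    have h1 : (edgeWalks 0 e).card ≤ 1 := by
      refine card_le_one.2 fun s hs t ht => funext fun i => ?_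
      simp only [edgeWalks, mem_filter, mem_univ, true_and] at hs ht
      obtain rfl : i = 0 := Fin.ext (by omega)
      rw [hs.1, ht.1]
    have h2 : n1 + n2 ≤ potential n1 n2 e := by
      rcases e with ⟨x | y, _ | _⟩ <;> simp only [potential] <;> omega
    nlinarith
  | succ k ih =>
    calc (n1 + n2) * (edgeWalks (k + 1) e).card
        ≤ (n1 + n2) * ∑ e' with MayFollow e e', (edgeWalks k e').card := by
          gcongr
          exact (card_le_card (edgeWalks_succ_subset k e)).trans
            (card_biUnion_le.trans (sum_le_sum fun _ _ => card_image_le))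
      _ ≤ ∑ e' with MayFollow e e', potential n1 n2 e' * (n1 + n2) ^ k := by
          rw [mul_sum]
          exact sum_le_sum fun e' _ => ih e'
      _ ≤ ((n1 + n2) * potential n1 n2 e) * (n1 + n2) ^ k := by
          rw [← sum_mul]
          gcongr
          exact sum_potential_le e
      _ = _ := by ring

/-- The sequences of `k + 1` oriented edges of distinct applicants that begin with a good start
and respect `MayFollow`. -/
def goodWalks (n1 n2 k : ℕ) : Finset (Fin (k + 1) → (Fin n1 ⊕ Fin n2) × Bool) :=
  univ.filter fun t => GoodStart (t 0) ∧ (∀ i : Fin k, MayFollow (t i.castSucc) (t i.succ)) ∧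
    Function.Injective fun i => (t i).1

lemma card_goodWalks_le (n1 n2 k : ℕ) : (goodWalks n1 n2 k).card ≤ (n1 + n2) ^ (k + 1) := by
  have hsub : goodWalks n1 n2 k ⊆ (univ.filter GoodStart).biUnion (edgeWalks k) := by
    intro t ht
    simp only [goodWalks, mem_filter, mem_univ, true_and] at ht
    simp only [mem_biUnion, edgeWalks, mem_filter, mem_univ, true_and]
    exact ⟨t 0, ht.1, rfl, ht.2.1⟩
  have hstart : ∀ e ∈ univ.filter (GoodStart (n1 := n1) (n2 := n2)),
      (edgeWalks k e).card ≤ (n1 + n2) ^ k := by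
    intro e he
    simp only [mem_filter, mem_univ, true_and] at he
    have hpos : 0 < n1 + n2 := by
      rcases e with ⟨x | y, _⟩
      · have := x.pos
        omega
      · have := y.pos
        omega
    have hpot : potential n1 n2 e = n1 + n2 := by
      rcases e with ⟨x | y, _ | _⟩ <;> simp_all [potential, GoodStart]
    have := card_edgeWalks_le k e
    rw [hpot] at this
    exact Nat.le_of_mul_le_mul_left this hpos
  have hcard : (univ.filter (GoodStart (n1 := n1) (n2 := n2))).card = n1 + n2 := by
    rw [card_filter, Fintype.sum_prod_type, Fintype.sum_sum_type]
    simp [GoodStart]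
  calc _ ≤ ∑ e with GoodStart e, (edgeWalks k e).card :=
        (card_le_card hsub).trans card_biUnion_le
    _ ≤ (n1 + n2) * (n1 + n2) ^ k := by
        refine (sum_le_card_nsmul _ _ _ hstart).trans_eq ?_
        rw [hcard, smul_eq_mul]
    _ = _ := by ring

/-! ### Cycles of valid outcomes -/

/-- Every edge of the sequence `t` runs, in its orientation, from `u i` to `u (i + 1)`
(cyclically). -/
def Traverses {n1 n2 m k : ℕ} (t : Fin (k + 1) → (Fin n1 ⊕ Fin n2) × Bool)
    (u : Fin (k + 1) → Fin m) (ω : FSSpace n1 n2 m) : Prop :=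
  ∀ i, firstItem ω (t i).1 = (if (t i).2 then u i else u (i + 1)) ∧
    secondItem ω (t i).1 = (if (t i).2 then u (i + 1) else u i)

lemma Traverses.mayFollow {n1 n2 m k : ℕ} {t : Fin (k + 1) → (Fin n1 ⊕ Fin n2) × Bool}
    {u : Fin (k + 1) → Fin m} {ω : FSSpace n1 n2 m} (h : Traverses t u ω) (hω : FSValid ω)
    (i : Fin (k + 1)) : MayFollow (t i) (t (i + 1)) := by
  obtain ⟨h1, h2, h3⟩ := hω
  simp only [FOne, FTwo, mem_union, mem_image, mem_univ, true_and, not_or, not_exists]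
    at h1 h2 h3
  have hi := h i
  have hj := h (i + 1)
  rcases hti : t i with ⟨x | y, _ | _⟩ <;> rcases htj : t (i + 1) with ⟨x' | y', _ | _⟩ <;>
    simp [hti, htj, firstItem, secondItem, MayFollow] at hi hj ⊢ <;> grind

lemma Traverses.rotate {n1 n2 m k : ℕ} {t : Fin (k + 1) → (Fin n1 ⊕ Fin n2) × Bool}
    {u : Fin (k + 1) → Fin m} {ω : FSSpace n1 n2 m} (h : Traverses t u ω) (i₀ : Fin (k + 1)) :
    Traverses (fun i => t (i₀ + i)) (fun i => u (i₀ + i)) ω := by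
  intro i
  simpa only [add_assoc] using h (i₀ + i)

lemma MayFollow.goodStart {n1 n2 : ℕ} {e e' e'' : (Fin n1 ⊕ Fin n2) × Bool}
    (h : MayFollow e e') (h' : MayFollow e' e'') : GoodStart e ∨ GoodStart e' ∨ GoodStart e'' := by
  rcases e with ⟨_ | _, _ | _⟩ <;> rcases e' with ⟨_ | _, _ | _⟩ <;>
    rcases e'' with ⟨_ | _, _ | _⟩ <;> simp_all [MayFollow, GoodStart]

lemma exists_goodStart {n1 n2 k : ℕ} {t : Fin (k + 1) → (Fin n1 ⊕ Fin n2) × Bool}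
    (h : ∀ i, MayFollow (t i) (t (i + 1))) : ∃ i, GoodStart (t i) := by
  rcases (h 0).goodStart (h (0 + 1)) with h' | h' | h'
  exacts [⟨_, h'⟩, ⟨_, h'⟩, ⟨_, h'⟩]

lemma exists_goodWalk_of_cycle {n1 n2 m : ℕ} {ω : FSSpace n1 n2 m} (hω : FSValid ω)
    (hcyc : fsHasCycle ω) :
    ∃ k < n1 + n2, ∃ t ∈ goodWalks n1 n2 (k + 1), ∃ u, Traverses t u ω := by
  obtain ⟨ℓ, u, e, hℓ, -, he, hjoin⟩ := hcyc
  obtain ⟨k, rfl⟩ := Nat.exists_eq_add_of_le' hℓ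
  have hinj : Function.Injective fun i : Fin (k + 1 + 1) => e i := fun i j hij =>
    Fin.ext (he i j i.2 j.2 hij)
  have horient : ∀ i : Fin (k + 1 + 1), ∃ o : Bool,
      firstItem ω (e i) = (if o then u i else u ↑(i + 1)) ∧
        secondItem ω (e i) = (if o then u ↑(i + 1) else u i) := by
    intro i
    have h := hjoin i i.2
    have hv : ((i + 1 : Fin (k + 1 + 1)) : ℕ) = ((i : ℕ) + 1) % (k + 2) := by
      rw [Fin.val_add]
      simp
    rw [hv]
    rcases hei : e i with x | y <;>
      simp only [hei, fsJoins, Sum.elim_inl, Sum.elim_inr] at h <;>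
      rcases h with ⟨h, h'⟩ | ⟨h, h'⟩
    · exact ⟨true, h, h'⟩
    · exact ⟨false, h, h'⟩
    · exact ⟨true, h, h'⟩
    · exact ⟨false, h, h'⟩
  choose o ho using horient
  have htrav : Traverses (fun i => (e i, o i)) (fun i => u i) ω := ho
  obtain ⟨i₀, hi₀⟩ := exists_goodStart (htrav.mayFollow hω)
  have hrot := htrav.rotate i₀
  refine ⟨k, ?_, _, ?_, _, hrot⟩
  · have := Fintype.card_le_of_injective _ hinj
    simp only [Fintype.card_fin, Fintype.card_sum] at this
    omega
  · simp only [goodWalks, mem_filter, mem_univ, true_and]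
    refine ⟨by simpa using hi₀, fun i => ?_, hinj.comp (add_right_injective i₀)⟩
    have := hrot.mayFollow hω i.castSucc
    rwa [Fin.coeSucc_eq_succ] at this

lemma fsProb_traverses_le {n1 n2 m k : ℕ} {K : ℝ} (hm : n1 + n2 < m)
    (hK : 1 / ((m : ℝ) - ((n1 + n2 : ℕ) : ℝ)) ≤ K)
    {t : Fin (k + 1) → (Fin n1 ⊕ Fin n2) × Bool} (ht : t ∈ goodWalks n1 n2 k)
    (u : Fin (k + 1) → Fin m) : fsProb n1 n2 m (Traverses t u) ≤ (K ^ 2) ^ (k + 1) := by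
  simp only [goodWalks, mem_filter, mem_univ, true_and] at ht
  have hinj := ht.2.2
  set a := fun i => (t i).1
  have hinv : ∀ i, Function.invFun a (a i) = i := Function.leftInverse_invFun hinj
  have hbound := fsProb_prescribed_le hm hK (univ.image a)
    (fun x => if (t (Function.invFun a x)).2 then u (Function.invFun a x)
      else u (Function.invFun a x + 1))
    (fun x => if (t (Function.invFun a x)).2 then u (Function.invFun a x + 1)
      else u (Function.invFun a x))
  rw [card_image_of_injective _ hinj, card_univ, Fintype.card_fin] at hbound
  convert hbound using 2
  ext ω
  simp only [Prescribes, mem_image, mem_univ, true_and, forall_exists_index, forall_apply_eq_imp_iff, hinv]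
  rfl

lemma sum_pow_add_two_le {r : ℝ} (h0 : 0 ≤ r) (h1 : r < 1) (N : ℕ) :
    ∑ k ∈ range N, r ^ (k + 2) ≤ r ^ 2 / (1 - r) := by
  rw [le_div_iff₀ (by linarith)]
  simp only [pow_add, ← sum_mul]
  have := geom_sum_mul_neg r N
  nlinarith [pow_nonneg h0 N, sq_nonneg r]

/-- In the random fs-relation graph model, if `m - n ≥ m/c` for a
constant `c > 1` and `c²n/m < 1`, then the probability that the random fs-relation
graph contains a cycle is at most `(c²n/m)² / (1 - c²n/m)`. -/
theorem cycle_prob_bound (n1 n2 m : ℕ) (c : ℝ) (hc : 1 < c)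
    (hm : n1 + n2 < m)
    (hmc : (m : ℝ) / c ≤ (m : ℝ) - ((n1 + n2 : ℕ) : ℝ))
    (hsmall : c ^ 2 * ((n1 + n2 : ℕ) : ℝ) / (m : ℝ) < 1) :
    fsProb n1 n2 m fsHasCycle ≤
      (c ^ 2 * ((n1 + n2 : ℕ) : ℝ) / (m : ℝ)) ^ 2 /
        (1 - c ^ 2 * ((n1 + n2 : ℕ) : ℝ) / (m : ℝ)) := by
  have hn0 : (0 : ℝ) ≤ ((n1 + n2 : ℕ) : ℝ) := Nat.cast_nonneg _
  have hm' : ((n1 + n2 : ℕ) : ℝ) < m := by exact_mod_cast hm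
  have hmpos : (0 : ℝ) < m := hn0.trans_lt hm'
  have hK : 1 / ((m : ℝ) - ((n1 + n2 : ℕ) : ℝ)) ≤ c / m := by
    rw [← one_div_div (m : ℝ) c]
    exact one_div_le_one_div_of_le (by positivity) hmc
  set r := c ^ 2 * ((n1 + n2 : ℕ) : ℝ) / (m : ℝ) with hr
  let I : Finset (Σ k : ℕ, (Fin (k + 2) → (Fin n1 ⊕ Fin n2) × Bool) × (Fin (k + 2) → Fin m)) :=
    (range (n1 + n2)).sigma fun k => goodWalks n1 n2 (k + 1) ×ˢ univ
  calc fsProb n1 n2 m fsHasCycle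
      ≤ ∑ w ∈ I, fsProb n1 n2 m (Traverses w.2.1 w.2.2) := by
        refine fsProb_le_sum I _ fun ω hω hcyc => ?_
        obtain ⟨k, hk, t, ht, u, htu⟩ := exists_goodWalk_of_cycle hω hcyc
        exact ⟨⟨k, t, u⟩, by simp [I, hk, ht], htu⟩
    _ ≤ ∑ k ∈ range (n1 + n2), r ^ (k + 2) := by
        rw [sum_sigma]
        refine sum_le_sum fun k _ => ?_
        calc _ ≤ (goodWalks n1 n2 (k + 1) ×ˢ (univ : Finset (Fin (k + 2) → Fin m))).card •
              ((c / m) ^ 2) ^ (k + 2) :=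
              sum_le_card_nsmul _ _ _ fun w hw =>
                fsProb_traverses_le hm hK (mem_product.1 hw).1 w.2
          _ ≤ (((n1 + n2 : ℕ) : ℝ) ^ (k + 2) * (m : ℝ) ^ (k + 2)) *
              ((c / m) ^ 2) ^ (k + 2) := by
              rw [nsmul_eq_mul]
              gcongr
              rw [card_product, card_univ, Fintype.card_fun, Fintype.card_fin, Fintype.card_fin]
              exact_mod_cast Nat.mul_le_mul_right _ (card_goodWalks_le n1 n2 (k + 1))
          _ = r ^ (k + 2) := by
              rw [← mul_pow, ← mul_pow, hr]
              congr 1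
              field_simp
    _ ≤ r ^ 2 / (1 - r) := sum_pow_add_two_le (by positivity) hsmall _
end
end

section
/- In the random fs-relation graph model, if m - n ≥ m/c for a constant c > 1 and c²n/m < 1, then the probability that the random fs-relation graph contains a simple path with at least 4 edges (and hence, in particular, any bad subgraph of type G1) is at most (c⁸·n⁴/m³) / (1 - c²n/m). -/
open scoped Classical
open Finset

noncomputable section

/-- The first item of an applicant. -/
def fItem {n1 n2 m : ℕ} (ω : FSSpace n1 n2 m) : Fin n1 ⊕ Fin n2 → Fin m :=
  Sum.elim (fOne ω) (fTwo ω)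

/-- The second item of an applicant. -/
def sItem {n1 n2 m : ℕ} (ω : FSSpace n1 n2 m) : Fin n1 ⊕ Fin n2 → Fin m :=
  Sum.elim (sOne ω) (sTwo ω)

/-- The end of the edge of `a` selected by `b`: the first item if `b` is true, and the second
item otherwise. -/
def endItem {n1 n2 m : ℕ} (ω : FSSpace n1 n2 m) (a : Fin n1 ⊕ Fin n2) (b : Bool) : Fin m :=
  cond b (fItem ω a) (sItem ω a)

/-- The weight of a function `s` that avoids `F` and agrees with `b` on `Y`, when its values are
independent and uniform outside `F`. -/
def avoidWeight {k m : ℕ} (F : Finset (Fin m)) (Y : Finset (Fin k)) (b s : Fin k → Fin m) : ℝ :=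
  if (∀ y, s y ∉ F) ∧ ∀ y ∈ Y, s y = b y then (1 / ((m : ℝ) - F.card)) ^ k else 0

lemma avoidWeight_nonneg {k m : ℕ} (F : Finset (Fin m)) (Y : Finset (Fin k))
    (b s : Fin k → Fin m) : 0 ≤ avoidWeight F Y b s := by
  have h : (F.card : ℝ) ≤ m := by exact_mod_cast (card_le_univ F).trans_eq (Fintype.card_fin m)
  unfold avoidWeight
  split_ifs
  · exact pow_nonneg (one_div_nonneg.2 (sub_nonneg.2 h)) _
  · exact le_rfl

lemma sum_avoidWeight_le {k m : ℕ} {c : ℝ} (hc : 0 < c) (hm : 0 < m) (F : Finset (Fin m))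
    (hF : (m : ℝ) / c ≤ (m : ℝ) - F.card) (Y : Finset (Fin k)) (b : Fin k → Fin m) :
    ∑ s, avoidWeight F Y b s ≤ (c / m) ^ Y.card := by
  have hm' : (0 : ℝ) < m := by exact_mod_cast hm
  set r : ℝ := (m : ℝ) - F.card with hr
  have hr0 : 0 < r := (div_pos hm' hc).trans_le hF
  have hrc : 1 / r ≤ c / m := by
    simpa using one_div_le_one_div_of_le (div_pos hm' hc) hF
  have hprod (s : Fin k → Fin m) : avoidWeight F Y b s =
      ∏ y, if s y ∉ F ∧ (y ∈ Y → s y = b y) then 1 / r else 0 := by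
    rw [Finset.prod_ite_zero]
    simp [avoidWeight, forall_and, ← hr]
  simp_rw [hprod]
  rw [← Fintype.prod_sum (fun y t => if t ∉ F ∧ (y ∈ Y → t = b y) then 1 / r else 0)]
  calc
    _ ≤ ∏ y, if y ∈ Y then c / m else 1 := by
      refine Finset.prod_le_prod (fun y _ => sum_nonneg fun t _ => ?_) fun y _ => ?_
      · split_ifs <;> positivity
      · by_cases hy : y ∈ Y
        · calc
            _ ≤ ∑ t, if t = b y then 1 / r else 0 := by
              refine sum_le_sum fun t _ => ?_
              by_cases ht : t = b y
              · simp only [ht, hy, and_true, implies_true, if_true]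
                split_ifs <;> first | exact le_rfl | positivity
              · simp [ht, hy]
            _ ≤ _ := by simpa [hy] using hrc
        · have hcard : ((Fᶜ).card : ℝ) = r := by
            rw [card_compl, Fintype.card_fin, Nat.cast_sub]
            exact (card_le_univ F).trans_eq (Fintype.card_fin m)
          have hfilter : (univ.filter fun t => t ∉ F) = Fᶜ := by ext; simp
          simp only [hy, false_implies, and_true, if_false]
          rw [← Finset.sum_filter, hfilter, sum_const, nsmul_eq_mul, hcard,
            mul_one_div_cancel hr0.ne']
    _ = _ := by
      rw [Finset.prod_ite]
      simp [div_pow]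

lemma fsProb_prescribed_le_s19 {n1 n2 m : ℕ} {c : ℝ} (hc : 1 < c) (hm : n1 + n2 < m)
    (hmc : (m : ℝ) / c ≤ (m : ℝ) - ((n1 + n2 : ℕ) : ℝ))
    (T : Finset (Fin n1 ⊕ Fin n2)) (p q : Fin n1 ⊕ Fin n2 → Fin m) :
    fsProb n1 n2 m (fun ω => ∀ a ∈ T, fItem ω a = p a ∧ sItem ω a = q a) ≤
      (c / m) ^ (2 * T.card) := by
  have hc0 : 0 < c := one_pos.trans hc
  have hm0 : 0 < m := by omega
  have hbound (F : Finset (Fin m)) (hF : F.card ≤ n1 + n2) :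
      (m : ℝ) / c ≤ (m : ℝ) - F.card := by
    have : (F.card : ℝ) ≤ ((n1 + n2 : ℕ) : ℝ) := by exact_mod_cast hF
    linarith
  let X := T.toLeft
  let Y := T.toRight
  let imf (f : Fin n1 → Fin m) : Finset (Fin m) := univ.image f
  let imu (f : Fin n1 → Fin m) (g : Fin n2 → Fin m) : Finset (Fin m) := imf f ∪ univ.image g
  have hcf (f) : (imf f).card ≤ n1 := by
    simpa using (card_image_le (s := (univ : Finset (Fin n1))) (f := f))
  have hcu (f g) : (imu f g).card ≤ n1 + n2 := by
    refine (card_union_le _ _).trans (add_le_add (hcf f) ?_)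
    simpa using (card_image_le (s := (univ : Finset (Fin n2))) (f := g))
  have hS (F : Finset (Fin m)) (hF : F.card ≤ n1 + n2) {k : ℕ} (Z : Finset (Fin k))
      (b : Fin k → Fin m) : ∑ s, avoidWeight F Z b s ≤ (c / m) ^ Z.card :=
    sum_avoidWeight_le hc0 hm0 F (hbound F hF) Z b
  let p1 := fun x => p (Sum.inl x)
  let q1 := fun x => q (Sum.inl x)
  let p2 := fun x => p (Sum.inr x)
  let q2 := fun x => q (Sum.inr x)
  let S : FSSpace n1 n2 m → Prop := fun ω => ∀ a ∈ T, fItem ω a = p a ∧ sItem ω a = q a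
  let R : FSSpace n1 n2 m → ℝ := fun ω =>
    avoidWeight ∅ X p1 ω.1 * (avoidWeight (imf ω.1) X q1 ω.2.1 *
      (avoidWeight (imf ω.1) Y p2 ω.2.2.1 * avoidWeight (imu ω.1 ω.2.2.1) Y q2 ω.2.2.2))
  have hR (ω) : 0 ≤ R ω := by
    refine mul_nonneg ?_ (mul_nonneg ?_ (mul_nonneg ?_ ?_)) <;> exact avoidWeight_nonneg _ _ _ _
  have hSR (ω) (hT : S ω) : fsWeight n1 n2 m ω ≤ R ω := by
    unfold fsWeight
    split_ifs with hv
    · obtain ⟨h1, h2, h3⟩ := hv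
      have e1 : ∀ x ∈ X, ω.1 x = p1 x := fun x hx => (hT _ (mem_toLeft.1 hx)).1
      have e2 : ∀ x ∈ X, ω.2.1 x = q1 x := fun x hx => (hT _ (mem_toLeft.1 hx)).2
      have e3 : ∀ x ∈ Y, ω.2.2.1 x = p2 x := fun x hx => (hT _ (mem_toRight.1 hx)).1
      have e4 : ∀ x ∈ Y, ω.2.2.2 x = q2 x := fun x hx => (hT _ (mem_toRight.1 hx)).2
      simp only [R]
      rw [avoidWeight, if_pos ⟨by simp, e1⟩, avoidWeight, if_pos ⟨h1, e2⟩, avoidWeight,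
        if_pos ⟨h2, e3⟩, avoidWeight, if_pos ⟨h3, e4⟩]
      simp only [card_empty, Nat.cast_zero, sub_zero, pow_add]
      apply le_of_eq
      simp only [imf, imu, FOne, FTwo, fOne, fTwo]
      ring
    · exact hR ω
  have hnest {ι : Type} [Fintype ι] (w g : ι → ℝ) (M N : ℝ) (hw : ∀ i, 0 ≤ w i)
      (hg : ∀ i, g i ≤ M) (hN : ∑ i, w i ≤ N) (hM : 0 ≤ M) : ∑ i, w i * g i ≤ N * M :=
    (sum_le_sum fun i _ => mul_le_mul_of_nonneg_left (hg i) (hw i)).trans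
      ((sum_mul univ w M).symm.trans_le (mul_le_mul_of_nonneg_right hN hM))
  calc
    fsProb n1 n2 m S ≤ ∑ ω, R ω := by
      refine sum_le_sum fun ω _ => ?_
      split_ifs with h
      · exact hSR ω h
      · exact hR ω
    _ = ∑ f1, avoidWeight ∅ X p1 f1 * ∑ s1, avoidWeight (imf f1) X q1 s1 *
        ∑ f2, avoidWeight (imf f1) Y p2 f2 * ∑ s2, avoidWeight (imu f1 f2) Y q2 s2 := by
      simp only [R, Fintype.sum_prod_type, mul_sum]
    _ ≤ (c / m) ^ X.card * ((c / m) ^ X.card * ((c / m) ^ Y.card * (c / m) ^ Y.card)) := by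
      refine hnest _ _ _ _ (avoidWeight_nonneg _ _ _) (fun f1 => ?_) (hS _ (by simp) _ _)
        (by positivity)
      have hf1 := (hcf f1).trans (Nat.le_add_right n1 n2)
      refine hnest _ _ _ _ (avoidWeight_nonneg _ _ _) (fun s1 => ?_) (hS _ hf1 _ _)
        (by positivity)
      exact hnest _ _ _ _ (avoidWeight_nonneg _ _ _) (fun f2 => hS _ (hcu f1 f2) _ _)
        (hS _ hf1 _ _) (by positivity)
    _ = _ := by
      rw [← card_toLeft_add_card_toRight (u := T)]
      simp only [X, Y]
      ring

/-- The applicants `e`, traversed with orientations `o`, form a path with vertices `v`. -/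
def IsOrientedPath {n1 n2 m ℓ : ℕ} (ω : FSSpace n1 n2 m) (v : Fin (ℓ + 1) → Fin m)
    (e : Fin ℓ → Fin n1 ⊕ Fin n2) (o : Fin ℓ → Bool) : Prop :=
  ∀ i, endItem ω (e i) (o i) = v i.castSucc ∧ endItem ω (e i) (!o i) = v i.succ

lemma fsProb_isOrientedPath_le {n1 n2 m ℓ : ℕ} {c : ℝ} (hc : 1 < c) (hm : n1 + n2 < m)
    (hmc : (m : ℝ) / c ≤ (m : ℝ) - ((n1 + n2 : ℕ) : ℝ)) (v : Fin (ℓ + 1) → Fin m)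
    {e : Fin ℓ → Fin n1 ⊕ Fin n2} (he : e.Injective) (o : Fin ℓ → Bool) :
    fsProb n1 n2 m (fun ω => IsOrientedPath ω v e o) ≤ (c / m) ^ (2 * ℓ) := by
  let p := Function.extend e (fun i => cond (o i) (v i.castSucc) (v i.succ)) fun _ => v 0
  let q := Function.extend e (fun i => cond (o i) (v i.succ) (v i.castSucc)) fun _ => v 0
  have h := fsProb_prescribed_le_s19 hc hm hmc (univ.image e) p q
  rw [card_image_of_injective _ he, card_univ, Fintype.card_fin] at h
  refine le_trans (le_of_eq ?_) h
  congr 1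
  funext ω
  simp only [IsOrientedPath, mem_image, mem_univ, true_and, forall_exists_index,
    forall_apply_eq_imp_iff, eq_iff_iff, p, q, he.extend_apply]
  refine forall_congr' fun i => ?_
  cases o i <;> simp [endItem, and_comm]

/-- Whether ends of edges of kinds `k`, `k'` (true for the first category) with roles `b`, `b'`
(true for first items) can be the same item. -/
def roleCompat (k k' b b' : Bool) : Bool :=
  (k == k' && b == b') || (k && !k' && !b) || (!k && k' && !b')

lemma roleCompat_of_endItem_eq {n1 n2 m : ℕ} {ω : FSSpace n1 n2 m} (hω : FSValid ω)
    {a a' : Fin n1 ⊕ Fin n2} {b b' : Bool} (h : endItem ω a b = endItem ω a' b') :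
    roleCompat a.isLeft a'.isLeft b b' = true := by
  obtain ⟨h1, h2, h3⟩ := hω
  have g1 (x x') : sOne ω x ≠ fOne ω x' := fun h =>
    h1 x (h ▸ mem_image_of_mem _ (mem_univ x'))
  have g2 (x x') : fTwo ω x ≠ fOne ω x' := fun h =>
    h2 x (h ▸ mem_image_of_mem _ (mem_univ x'))
  have g3 (x x') : sTwo ω x ≠ fOne ω x' := fun h =>
    h3 x (mem_union_left _ (h ▸ mem_image_of_mem _ (mem_univ x')))
  have g4 (x x') : sTwo ω x ≠ fTwo ω x' := fun h =>
    h3 x (mem_union_right _ (h ▸ mem_image_of_mem _ (mem_univ x')))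
  rcases a with x | x <;> rcases a' with x' | x' <;> cases b <;> cases b' <;>
    simp_all [roleCompat, endItem, fItem, sItem, (g1 _ _).symm, (g2 _ _).symm, (g3 _ _).symm,
      (g4 _ _).symm]

/-- Whether a path of four edges of kinds `k` can have orientations `o`. -/
def pathCompat (k o : Fin 4 → Bool) : Bool :=
  roleCompat (k 0) (k 1) (!o 0) (o 1) && roleCompat (k 1) (k 2) (!o 1) (o 2) &&
    roleCompat (k 2) (k 3) (!o 2) (o 3)

lemma pathCompat_of_isOrientedPath {n1 n2 m : ℕ} {ω : FSSpace n1 n2 m} (hω : FSValid ω)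
    {v : Fin 5 → Fin m} {e : Fin 4 → Fin n1 ⊕ Fin n2} {o : Fin 4 → Bool}
    (h : IsOrientedPath ω v e o) : pathCompat (fun i => (e i).isLeft) o = true := by
  simp only [pathCompat, Bool.and_eq_true]
  exact ⟨⟨roleCompat_of_endItem_eq hω ((h 0).2.trans (h 1).1.symm),
    roleCompat_of_endItem_eq hω ((h 1).2.trans (h 2).1.symm)⟩,
    roleCompat_of_endItem_eq hω ((h 2).2.trans (h 3).1.symm)⟩

/-- Only the alternation of kinds `2112` allows four orientations, and its transposition `2121`
allows none. -/
lemma card_pathCompat_add_swap_le : ∀ k : Fin 4 → Bool,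
    (univ.filter fun o => pathCompat k o = true).card +
      (univ.filter fun o => pathCompat (k ∘ Equiv.swap 2 3) o = true).card ≤ 4 := by
  decide +kernel

lemma sum_card_pathCompat_le (n1 n2 : ℕ) :
    ∑ e : Fin 4 → Fin n1 ⊕ Fin n2,
      (univ.filter fun o => pathCompat (fun i => (e i).isLeft) o = true).card ≤
        2 * (n1 + n2) ^ 4 := by
  set G : (Fin 4 → Fin n1 ⊕ Fin n2) → ℕ := fun e =>
    (univ.filter fun o => pathCompat (fun i => (e i).isLeft) o = true).card
  have hswap : ∑ e, G (e ∘ Equiv.swap 2 3) = ∑ e, G e :=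
    Equiv.sum_comp ((Equiv.swap (2 : Fin 4) 3).arrowCongr (Equiv.refl (Fin n1 ⊕ Fin n2))) G
  have h : ∑ e, (G e + G (e ∘ Equiv.swap 2 3)) ≤ ∑ _e : Fin 4 → Fin n1 ⊕ Fin n2, 4 :=
    sum_le_sum fun e _ => card_pathCompat_add_swap_le fun i => (e i).isLeft
  rw [sum_add_distrib, hswap] at h
  simp only [sum_const, card_univ, Fintype.card_fun, Fintype.card_sum, Fintype.card_fin,
    smul_eq_mul] at h
  change ∑ e, G e ≤ _
  omega

/-- Reversing an oriented path. -/
lemma IsOrientedPath.reverse {n1 n2 m ℓ : ℕ} {ω : FSSpace n1 n2 m} {v : Fin (ℓ + 1) → Fin m}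
    {e : Fin ℓ → Fin n1 ⊕ Fin n2} {o : Fin ℓ → Bool} (h : IsOrientedPath ω v e o) :
    IsOrientedPath ω (v ∘ Fin.rev) (e ∘ Fin.rev) (fun i => !o i.rev) := by
  intro i
  have := h i.rev
  simp only [Function.comp_apply, Bool.not_not, Fin.rev_castSucc, Fin.rev_succ]
  exact this.symm

lemma exists_isOrientedPath {n1 n2 m : ℕ} {ω : FSSpace n1 n2 m} (h : fsHasLongPath ω) :
    ∃ (v : Fin 5 → Fin m) (e : Fin 4 → Fin n1 ⊕ Fin n2) (o : Fin 4 → Bool),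
      v.Injective ∧ e.Injective ∧ IsOrientedPath ω v e o := by
  obtain ⟨ℓ, v, e, hℓ, hv, he, hj⟩ := h
  have ho (i : Fin 4) : ∃ b, endItem ω (e i) b = v i ∧ endItem ω (e i) (!b) = v (i + 1) := by
    have := hj i (by omega)
    rcases hei : e i with x | y <;> rw [hei] at this <;> rcases this with h | h
    · exact ⟨true, h⟩
    · exact ⟨false, h.symm⟩
    · exact ⟨true, h⟩
    · exact ⟨false, h.symm⟩
  choose o ho using ho
  refine ⟨fun i => v i, fun i => e i, o, fun i j hij => ?_, fun i j hij => ?_, fun i => ?_⟩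
  · exact Fin.ext (hv _ _ (by omega) (by omega) hij)
  · exact Fin.ext (he _ _ (by omega) (by omega) hij)
  · simpa using ho i

/-- Vertices, edges and orientations of the potential paths with four edges. -/
def pathCandidates (n1 n2 m : ℕ) :
    Finset ((Fin 5 → Fin m) × (Fin 4 → Fin n1 ⊕ Fin n2) × (Fin 4 → Bool)) :=
  univ.filter fun t => t.2.1.Injective ∧ pathCompat (fun i => (t.2.1 i).isLeft) t.2.2 = true

lemma card_pathCandidates_le (n1 n2 m : ℕ) :
    (pathCandidates n1 n2 m).card ≤ m ^ 5 * (2 * (n1 + n2) ^ 4) := by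
  calc
    _ ≤ (univ.filter fun t : (Fin 5 → Fin m) × (Fin 4 → Fin n1 ⊕ Fin n2) × (Fin 4 → Bool) =>
        pathCompat (fun i => (t.2.1 i).isLeft) t.2.2 = true).card :=
      card_le_card (monotone_filter_right _ fun _ _ h => h.2)
    _ = ∑ _v : Fin 5 → Fin m, ∑ e : Fin 4 → Fin n1 ⊕ Fin n2,
        (univ.filter fun o => pathCompat (fun i => (e i).isLeft) o = true).card := by
      simp only [card_filter, Fintype.sum_prod_type]
    _ = m ^ 5 * ∑ e : Fin 4 → Fin n1 ⊕ Fin n2,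
        (univ.filter fun o => pathCompat (fun i => (e i).isLeft) o = true).card := by
      rw [sum_const]
      simp
    _ ≤ _ := Nat.mul_le_mul_left _ (sum_card_pathCompat_le n1 n2)

/-- A long path is counted at least twice, once in each direction. -/
lemma two_le_card_pathCandidates {n1 n2 m : ℕ} {ω : FSSpace n1 n2 m} (hω : FSValid ω)
    (h : fsHasLongPath ω) :
    2 ≤ ((pathCandidates n1 n2 m).filter fun t => IsOrientedPath ω t.1 t.2.1 t.2.2).card := by
  obtain ⟨v, e, o, hv, he, hp⟩ := exists_isOrientedPath h
  refine one_lt_card.2 ⟨(v, e, o), ?_, (v ∘ Fin.rev, e ∘ Fin.rev, fun i => !o i.rev), ?_, ?_⟩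
  · simpa [pathCandidates, he, hp] using pathCompat_of_isOrientedPath hω hp
  · simpa [pathCandidates, he.comp Fin.rev_injective, hp.reverse] using
      pathCompat_of_isOrientedPath hω hp.reverse
  · intro heq
    have h0 : (0 : Fin 5) = Fin.rev 0 := hv (congrFun (congrArg Prod.fst heq) 0)
    exact absurd h0 (by decide)

lemma two_mul_fsProb_fsHasLongPath_le (n1 n2 m : ℕ) :
    2 * fsProb n1 n2 m fsHasLongPath ≤ ∑ t ∈ pathCandidates n1 n2 m,
      fsProb n1 n2 m (fun ω => IsOrientedPath ω t.1 t.2.1 t.2.2) := by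
  unfold fsProb
  rw [sum_comm, mul_sum]
  refine sum_le_sum fun ω _ => ?_
  rw [← sum_filter, sum_const, nsmul_eq_mul]
  have hw := fsWeight_nonneg ω
  split_ifs with h
  · by_cases hω : FSValid ω
    · exact mul_le_mul_of_nonneg_right (by exact_mod_cast two_le_card_pathCandidates hω h) hw
    · simp [fsWeight, hω]
  · simpa using mul_nonneg (Nat.cast_nonneg _) hw

/-- In the random fs-relation graph model, if `m - n ≥ m/c` for a
constant `c > 1` and `c²n/m < 1`, then the probability that the random fs-relation
graph contains a simple path with at least `4` edges is at most
`(c⁸n⁴/m³) / (1 - c²n/m)`. -/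
theorem long_path_prob_bound (n1 n2 m : ℕ) (c : ℝ) (hc : 1 < c)
    (hm : n1 + n2 < m)
    (hmc : (m : ℝ) / c ≤ (m : ℝ) - ((n1 + n2 : ℕ) : ℝ))
    (hsmall : c ^ 2 * ((n1 + n2 : ℕ) : ℝ) / (m : ℝ) < 1) :
    fsProb n1 n2 m fsHasLongPath ≤
      c ^ 8 * ((n1 + n2 : ℕ) : ℝ) ^ 4 / (m : ℝ) ^ 3 /
        (1 - c ^ 2 * ((n1 + n2 : ℕ) : ℝ) / (m : ℝ)) := by
  have hm0 : (0 : ℝ) < m := by exact_mod_cast (by omega : 0 < m)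
  set n : ℝ := ((n1 + n2 : ℕ) : ℝ) with hn
  have hn0 : 0 ≤ n := Nat.cast_nonneg _
  have hcard : ((pathCandidates n1 n2 m).card : ℝ) ≤ m ^ 5 * (2 * n ^ 4) := by
    rw [hn]
    exact_mod_cast card_pathCandidates_le n1 n2 m
  have hsum : ∑ t ∈ pathCandidates n1 n2 m,
      fsProb n1 n2 m (fun ω => IsOrientedPath ω t.1 t.2.1 t.2.2) ≤
        m ^ 5 * (2 * n ^ 4) * (c / m) ^ 8 := by
    refine (sum_le_card_nsmul _ _ _ fun t ht =>
      fsProb_isOrientedPath_le hc hm hmc t.1 (mem_filter.1 ht).2.1 t.2.2).trans ?_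
    rw [nsmul_eq_mul]
    exact mul_le_mul_of_nonneg_right hcard (by positivity)
  have hfour : fsProb n1 n2 m fsHasLongPath ≤ c ^ 8 * n ^ 4 / m ^ 3 := by
    have heq : (m : ℝ) ^ 5 * (2 * n ^ 4) * (c / m) ^ 8 = 2 * (c ^ 8 * n ^ 4 / m ^ 3) := by
      field_simp
    linarith [two_mul_fsProb_fsHasLongPath_le n1 n2 m]
  refine hfour.trans (le_div_self (by positivity) (by linarith) ?_)
  have : 0 ≤ c ^ 2 * n / m := by positivity
  linarith
end
end
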